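/- arXiv:1806.06186 — 2 statements merged into one kernel-verified Lean document; each statement's English description precedes it below -/
import Mathlib

section
/- Let R : 𝔻 → ℂ be holomorphic and injective on the open unit disc 𝔻. Then for Lebesgue-almost every θ ∈ [0,2π), lim_{r→1⁻} log|R′(r·e^{iθ})| / log(1−r) = 0; equivalently, for almost every boundary direction ζ = e^{iθ}, lim_{r→1⁻} (−log|R′(rζ)|)/log(1−r) = 0. -/
open Metric Complex MeasureTheory Filter

/-- An injective holomorphic function on a disc has an open image and a holomorphic left inverse. -/
lemma univalent_inverse {f : ℂ → ℂ} {a : ℂ} {s : ℝ} (hs : 0 < s)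
    (hf : DifferentiableOn ℂ f (ball a s)) (hinj : Set.InjOn f (ball a s)) :
    ∃ g : ℂ → ℂ, (∀ z ∈ ball a s, g (f z) = z) ∧
      ∀ z ∈ ball a s, DifferentiableAt ℂ g (f z) := by
  classical
  have hA : AnalyticOnNhd ℂ f (ball a s) := hf.analyticOnNhd isOpen_ball
  have haU : a ∈ ball a s := mem_ball_self hs
  have hopen : ∀ t ⊆ ball a s, IsOpen t → IsOpen (f '' t) := by
    rcases hA.is_constant_or_isOpen (convex_ball a s).isPreconnected with ⟨w, hw⟩ | h
    · exfalso
      have hb : a + (s / 2 : ℝ) ∈ ball a s := by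
        simp only [mem_ball, dist_eq_norm, add_sub_cancel_left, Complex.norm_real, Real.norm_eq_abs]
        rw [abs_of_pos (by linarith)]
        linarith
      have := hinj haU hb (by rw [hw _ haU, hw _ hb])
      have h2 : ((s / 2 : ℝ) : ℂ) = 0 := by simpa using this
      have h3 : s / 2 = 0 := by exact_mod_cast h2
      linarith
    · exact h
  obtain ⟨g, hg⟩ : ∃ g : ℂ → ℂ, ∀ z ∈ ball a s, g (f z) = z :=
    ⟨Function.invFunOn f (ball a s), fun z hz => hinj.leftInvOn_invFunOn hz⟩
  have hcont : ∀ z ∈ ball a s, ContinuousAt g (f z) := by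
    intro z hz V hV
    rw [hg z hz] at hV
    have hO := hopen (interior V ∩ ball a s) Set.inter_subset_right
      (isOpen_interior.inter isOpen_ball)
    have hm : f '' (interior V ∩ ball a s) ∈ nhds (f z) :=
      hO.mem_nhds ⟨z, ⟨mem_interior_iff_mem_nhds.2 hV, hz⟩, rfl⟩
    rw [Filter.mem_map]
    filter_upwards [hm] with y hy
    obtain ⟨x, ⟨hx1, hx2⟩, rfl⟩ := hy
    show g (f x) ∈ V
    rw [hg x hx2]
    exact interior_subset hx1
  have hnb : ∀ z ∈ ball a s, f '' (ball a s) ∈ nhds (f z) := fun z hz =>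
    (hopen _ subset_rfl isOpen_ball).mem_nhds ⟨z, hz, rfl⟩
  have hd1 : ∀ z ∈ ball a s, deriv f z ≠ 0 → DifferentiableAt ℂ g (f z) := by
    intro z hz hne
    refine (HasDerivAt.of_local_left_inverse (f := f) (f' := deriv f z) (hcont z hz) ?_ hne ?_
      ).differentiableAt
    · rw [hg z hz]
      exact (hf.differentiableAt (isOpen_ball.mem_nhds hz)).hasDerivAt
    · filter_upwards [hnb z hz] with y hy
      obtain ⟨x, hx, rfl⟩ := hy
      rw [hg x hx]
  refine ⟨g, hg, fun z hz => ?_⟩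
  refine (Complex.analyticAt_of_differentiable_on_punctured_nhds_of_continuousAt ?_
    (hcont z hz)).differentiableAt
  have hne : ∀ᶠ x in nhdsWithin z {z}ᶜ, deriv f x ≠ 0 := by
    rcases (hA z hz).deriv.eventually_eq_zero_or_eventually_ne_zero with h | h
    · exfalso
      obtain ⟨e, he, hsub⟩ := Metric.mem_nhds_iff.1 (h.and (isOpen_ball.mem_nhds hz))
      have hb : z + (e / 2 : ℝ) ∈ ball z e := by
        simp only [mem_ball, dist_eq_norm, add_sub_cancel_left, Complex.norm_real, Real.norm_eq_abs]
        rw [abs_of_pos (by linarith)]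
        linarith
      have heq : f z = f (z + (e / 2 : ℝ)) :=
        isOpen_ball.is_const_of_deriv_eq_zero (convex_ball z e).isPreconnected
          (hf.mono fun x hx => (hsub hx).2) (fun x hx => (hsub hx).1) (mem_ball_self he) hb
      have := hinj hz (hsub hb).2 heq
      have h2 : ((e / 2 : ℝ) : ℂ) = 0 := by simpa using this
      have h3 : e / 2 = 0 := by exact_mod_cast h2
      linarith
    · exact h
  -- transport to the image
  rw [eventually_nhdsWithin_iff] at hne ⊢
  have h1 := (hcont z hz).eventually (p := fun x => x ∈ ({z} : Set ℂ)ᶜ → deriv f x ≠ 0)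
    (by rw [hg z hz]; exact hne)
  filter_upwards [h1, hnb z hz] with y hy1 hy2 hy3
  obtain ⟨x, hx, rfl⟩ := hy2
  rw [hg x hx] at hy1
  exact hd1 x hx (hy1 fun h => hy3 (by rw [Set.mem_singleton_iff.1 h]; rfl))

lemma univalent_deriv_ne_zero {f : ℂ → ℂ} {a : ℂ} {s : ℝ} (hs : 0 < s)
    (hf : DifferentiableOn ℂ f (ball a s)) (hinj : Set.InjOn f (ball a s))
    {z : ℂ} (hz : z ∈ ball a s) : deriv f z ≠ 0 := by
  obtain ⟨g, hg, hgd⟩ := univalent_inverse hs hf hinj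
  have hfz := (hf.differentiableAt (isOpen_ball.mem_nhds hz)).hasDerivAt
  have h1 := (hgd z hz).hasDerivAt.comp z hfz
  have h2 : HasDerivAt (g ∘ f) 1 z := by
    refine (hasDerivAt_id z).congr_of_eventuallyEq ?_
    filter_upwards [isOpen_ball.mem_nhds hz] with x hx
    exact hg x hx
  intro h0
  have := h1.unique h2
  rw [h0] at this
  simp at this

/-- A univalent function omits a value close to its central value. -/
lemma univalent_omits {f : ℂ → ℂ} {a : ℂ} {s : ℝ} (hs : 0 < s)
    (hf : DifferentiableOn ℂ f (ball a s)) (hinj : Set.InjOn f (ball a s)) :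
    ∃ w : ℂ, (∀ z ∈ ball a s, f z ≠ w) ∧ ‖f a - w‖ ≤ 2 * s * ‖deriv f a‖ := by
  by_contra hcon
  push Not at hcon
  have haU : a ∈ ball a s := mem_ball_self hs
  have hne := univalent_deriv_ne_zero hs hf hinj haU
  have hpos : 0 < ‖deriv f a‖ := norm_pos_iff.2 hne
  set ρ := 2 * s * ‖deriv f a‖ with hρ
  have hρpos : 0 < ρ := by positivity
  have hsurj : ∀ w ∈ ball (f a) ρ, ∃ z ∈ ball a s, f z = w := by
    intro w hw
    by_contra hno
    push Not at hno
    have := hcon w hno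
    rw [mem_ball, dist_eq_norm, norm_sub_rev] at hw
    linarith
  obtain ⟨g, hg, hgd⟩ := univalent_inverse hs hf hinj
  have hb := Complex.norm_deriv_le_div_of_mapsTo_ball (f := g) (c := f a) (R₁ := ρ) (R₂ := s)
    (fun w hw => by
      obtain ⟨z, hz, rfl⟩ := hsurj w hw
      exact (hgd z hz).differentiableWithinAt)
    (fun w hw => by
      obtain ⟨z, hz, rfl⟩ := hsurj w hw
      rw [hg z hz, hg a haU]
      exact ball_subset_closedBall hz) hρpos
  have hfz := (hf.differentiableAt (isOpen_ball.mem_nhds haU)).hasDerivAt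
  have h1 := (hgd a haU).hasDerivAt.comp a hfz
  have h2 : HasDerivAt (g ∘ f) 1 a := by
    refine (hasDerivAt_id a).congr_of_eventuallyEq ?_
    filter_upwards [isOpen_ball.mem_nhds haU] with x hx
    exact hg x hx
  have h3 := congrArg norm (h1.unique h2)
  rw [norm_mul, norm_one] at h3
  have h4 : ‖deriv g (f a)‖ * ‖deriv f a‖ ≤ s / ρ * ‖deriv f a‖ :=
    mul_le_mul_of_nonneg_right hb hpos.le
  have h5 : s / ρ * ‖deriv f a‖ = 1 / 2 := by
    rw [hρ]; field_simp
  linarith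

/-- Holomorphic logarithm of a nonvanishing function on a disc. -/
lemma exists_holo_log {h : ℂ → ℂ} {a : ℂ} {s : ℝ} (hs : 0 < s)
    (hh : DifferentiableOn ℂ h (ball a s)) (h0 : ∀ z ∈ ball a s, h z ≠ 0) :
    ∃ q : ℂ → ℂ, DifferentiableOn ℂ q (ball a s) ∧ (∀ z ∈ ball a s, h z = exp (q z)) ∧
      ∀ z ∈ ball a s, deriv q z = deriv h z / h z := by
  have hq' : DifferentiableOn ℂ (fun z => deriv h z / h z) (ball a s) :=
    (hh.deriv isOpen_ball).div hh h0
  obtain ⟨q, hqa, hq⟩ := hq'.isExactOn_ball.with_val_at a (Complex.log (h a))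
  have haU : a ∈ ball a s := mem_ball_self hs
  have hd : ∀ z ∈ ball a s, HasDerivAt (fun z => h z * exp (-q z)) 0 z := by
    intro z hz
    have h1 := (hh.differentiableAt (isOpen_ball.mem_nhds hz)).hasDerivAt
    have h2 := h1.mul ((hq z hz).neg.cexp)
    convert! h2 using 1
    have := h0 z hz
    field_simp
    ring
  refine ⟨q, fun z hz => (hq z hz).differentiableAt.differentiableWithinAt, fun z hz => ?_,
    fun z hz => (hq z hz).deriv⟩
  have heq : h z * exp (-q z) = h a * exp (-q a) :=
    isOpen_ball.is_const_of_deriv_eq_zero (convex_ball a s).isPreconnected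
      (fun x hx => (hd x hx).differentiableAt.differentiableWithinAt)
      (fun x hx => (hd x hx).deriv) hz haU
  rw [hqa, Complex.exp_neg (Complex.log _), Complex.exp_log (h0 a haU),
    mul_inv_cancel₀ (h0 a haU), Complex.exp_neg] at heq
  field_simp at heq
  exact heq

/-- Bloch-type estimate: a function with no two values differing by `2πi`. -/
lemma bloch_estimate {q : ℂ → ℂ} {a : ℂ} {s : ℝ} (hs : 0 < s)
    (hq : DifferentiableOn ℂ q (ball a s))
    (hno : ∀ z ∈ ball a s, ∀ w ∈ ball a s, q w ≠ q z + 2 * Real.pi * I) :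
    s * ‖deriv q a‖ ≤ 192 * Real.pi := by
  set t := s / 2 with ht
  have htpos : 0 < t := by positivity
  have hsub : closedBall a t ⊆ ball a s := closedBall_subset_ball (by linarith)
  have hq' : DifferentiableOn ℂ (deriv q) (ball a s) := hq.deriv isOpen_ball
  obtain ⟨z₀, hz₀, hmax⟩ := (isCompact_closedBall a t).exists_isMaxOn
    (f := fun z => (t - dist z a) * ‖deriv q z‖) ⟨a, mem_closedBall_self htpos.le⟩
    ((continuousOn_const.sub (continuous_id.dist continuous_const).continuousOn).mul
      (hq'.continuousOn.mono hsub).norm)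
  set m := (t - dist z₀ a) * ‖deriv q z₀‖ with hm
  have hmax' : ∀ z ∈ closedBall a t, (t - dist z a) * ‖deriv q z‖ ≤ m := fun z hz => hmax hz
  have ha := hmax' a (mem_closedBall_self htpos.le)
  rw [dist_self, sub_zero] at ha
  suffices hmm : m ≤ 96 * Real.pi by
    have : s * ‖deriv q a‖ = 2 * (t * ‖deriv q a‖) := by rw [ht]; ring
    linarith
  by_contra hlt
  push Not at hlt
  have hmpos : 0 < m := lt_trans (by positivity) hlt
  have hd0 : 0 ≤ t - dist z₀ a := by
    have := mem_closedBall.1 hz₀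
    linarith
  have hD : 0 < ‖deriv q z₀‖ := by
    rcases (norm_nonneg (deriv q z₀)).eq_or_lt with h | h
    · rw [hm, ← h, mul_zero] at hmpos; exact absurd hmpos (lt_irrefl _)
    · exact h
  have hd : 0 < t - dist z₀ a := by
    rcases hd0.eq_or_lt with h | h
    · rw [hm, ← h, zero_mul] at hmpos; exact absurd hmpos (lt_irrefl _)
    · exact h
  set D := ‖deriv q z₀‖ with hDdef
  set τ := (t - dist z₀ a) / 2 with hτ
  have hτpos : 0 < τ := by positivity
  have hmτ : m = 2 * τ * D := by rw [hm, hτ]; ring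
  have hballτ : ∀ z ∈ ball z₀ τ, τ ≤ t - dist z a := by
    intro z hz
    have h1 := dist_triangle z z₀ a
    have h2 := mem_ball.1 hz
    have : t - dist z₀ a = 2 * τ := by rw [hτ]; ring
    linarith
  have hin : ball z₀ τ ⊆ ball a s := by
    intro z hz
    apply hsub
    have := hballτ z hz
    rw [mem_closedBall]
    linarith
  have hbd : ∀ z ∈ ball z₀ τ, ‖deriv q z‖ ≤ 2 * D := by
    intro z hz
    have h1 := hballτ z hz
    have h2 := hmax' z (by rw [mem_closedBall]; linarith)
    have h3 : τ * ‖deriv q z‖ ≤ τ * (2 * D) := by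
      calc τ * ‖deriv q z‖ ≤ (t - dist z a) * ‖deriv q z‖ := by gcongr
        _ ≤ m := h2
        _ = τ * (2 * D) := by rw [hmτ]; ring
    exact le_of_mul_le_mul_left h3 hτpos
  have hschw : ∀ z ∈ ball z₀ τ, ‖deriv q z - deriv q z₀‖ ≤ 3 * D / τ * dist z z₀ := by
    intro z hz
    rw [← dist_eq_norm]
    refine Complex.dist_le_div_mul_dist_of_mapsTo_ball (hq'.mono hin) ?_ hz
    intro x hx
    rw [mem_closedBall, dist_eq_norm]
    calc ‖deriv q x - deriv q z₀‖ ≤ ‖deriv q x‖ + ‖deriv q z₀‖ := norm_sub_le _ _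
      _ ≤ 3 * D := by have := hbd x hx; linarith
  have hin6 : closedBall z₀ (τ / 6) ⊆ ball z₀ τ := closedBall_subset_ball (by linarith)
  have hlin : ∀ z ∈ closedBall z₀ (τ / 6),
      ‖(q z - deriv q z₀ * z) - (q z₀ - deriv q z₀ * z₀)‖ ≤ D / 2 * ‖z - z₀‖ := by
    intro z hz
    refine (convex_closedBall z₀ (τ / 6)).norm_image_sub_le_of_norm_hasDerivWithin_le
      (f := fun z => q z - deriv q z₀ * z) (f' := fun z => deriv q z - deriv q z₀)
      (fun x hx => ?_) (fun x hx => ?_) (mem_closedBall_self (by positivity)) hz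
    · have h1 := (hq.differentiableAt (isOpen_ball.mem_nhds (hin (hin6 hx)))).hasDerivAt
      have h2 := (hasDerivAt_id x).const_mul (deriv q z₀)
      have h3 := h1.sub h2
      rw [mul_one] at h3
      exact h3.hasDerivWithinAt
    · refine (hschw x (hin6 hx)).trans ?_
      have := mem_closedBall.1 hx
      calc 3 * D / τ * dist x z₀ ≤ 3 * D / τ * (τ / 6) := by gcongr
        _ = D / 2 := by field_simp; norm_num
  have hsph : ∀ z ∈ sphere z₀ (τ / 6), D * τ / 12 ≤ ‖q z - q z₀‖ := by
    intro z hz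
    have h1 := hlin z (sphere_subset_closedBall hz)
    have h2 : ‖z - z₀‖ = τ / 6 := by rw [← dist_eq_norm]; exact hz
    have h3 : deriv q z₀ * (z - z₀) =
        (q z - q z₀) - ((q z - deriv q z₀ * z) - (q z₀ - deriv q z₀ * z₀)) := by ring
    have h4 := norm_sub_le (q z - q z₀) ((q z - deriv q z₀ * z) - (q z₀ - deriv q z₀ * z₀))
    rw [← h3, norm_mul, h2] at h4
    rw [h2] at h1
    have h5 : D * (τ / 6) = D * τ / 12 + D / 2 * (τ / 6) := by ring
    linarith
  have hcl : DiffContOnCl ℂ q (ball z₀ (τ / 6)) := by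
    apply DifferentiableOn.diffContOnCl
    exact hq.mono (closure_ball_subset_closedBall.trans (hin6.trans hin))
  have hz₀s : z₀ ∈ ball a s := hsub hz₀
  have hcover := hcl.ball_subset_image_closedBall (by positivity) hsph (by
    have h1 := (hq.differentiableAt (isOpen_ball.mem_nhds hz₀s)).hasDerivAt
    have h2 := h1.eventually_ne (c := q z₀) (norm_pos_iff.1 hD)
    exact h2.frequently.filter_mono nhdsWithin_le_nhds)
  have hmem : q z₀ + 2 * Real.pi * I ∈ ball (q z₀) (D * τ / 12 / 2) := by
    rw [mem_ball, dist_eq_norm, add_sub_cancel_left]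
    have : ‖(2 * Real.pi * I : ℂ)‖ = 2 * Real.pi := by
      simp [abs_of_pos Real.pi_pos]
    rw [this]
    nlinarith
  obtain ⟨x, hx, hxe⟩ := hcover hmem
  exact hno z₀ hz₀s x (hin (hin6 hx)) hxe

/-- Pre-Schwarzian bound for univalent functions. -/
lemma univalent_preschwarzian :
    ∃ C : ℝ, 0 < C ∧ ∀ (f : ℂ → ℂ) (a : ℂ) (s : ℝ), 0 < s → DifferentiableOn ℂ f (ball a s) →
      Set.InjOn f (ball a s) → s * ‖deriv (deriv f) a‖ ≤ C * ‖deriv f a‖ := by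
  set K : ℝ := 192 * Real.pi with hK
  have hKpos : 0 < K := by positivity
  refine ⟨2 * (8 * K + K ^ 2), by positivity, ?_⟩
  intro f a s hs hf hinj
  obtain ⟨w, hw, hwa⟩ := univalent_omits hs hf hinj
  have haU : a ∈ ball a s := mem_ball_self hs
  have hne : ∀ z ∈ ball a s, f z - w ≠ 0 := fun z hz => sub_ne_zero.2 (hw z hz)
  obtain ⟨q, hq, hexp, hqd⟩ := exists_holo_log hs (hf.sub_const w) hne
  have hno : ∀ z ∈ ball a s, ∀ x ∈ ball a s, q x ≠ q z + 2 * Real.pi * I := by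
    intro z hz x hx h
    have h1 : f x - w = f z - w := by
      rw [hexp x hx, hexp z hz, h, Complex.exp_periodic]
    have h2 := hinj hx hz (sub_left_injective h1)
    rw [h2] at h
    have h3 : (2 * Real.pi * I : ℂ) = 0 := by
      have := h.symm
      simp at this
    exact Complex.two_pi_I_ne_zero h3
  have hq' : DifferentiableOn ℂ (deriv q) (ball a s) := hq.deriv isOpen_ball
  have hb : ∀ z ∈ closedBall a (s / 2), ‖deriv q z‖ ≤ 2 * K / s := by
    intro z hz
    have hsub : ball z (s / 2) ⊆ ball a s := ball_subset_ball' (by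
      have := mem_closedBall.1 hz
      linarith)
    have := bloch_estimate (half_pos hs) (hq.mono hsub)
      (fun x hx y hy => hno x (hsub hx) y (hsub hy))
    rw [le_div_iff₀ hs]
    nlinarith
  have h1 : ‖deriv q a‖ ≤ K / s := by
    rw [le_div_iff₀ hs]
    have := bloch_estimate hs hq hno
    linarith
  have h2 : ‖deriv (deriv q) a‖ ≤ (2 * K / s) / (s / 2) := by
    refine Complex.norm_deriv_le_of_forall_mem_sphere_norm_le (half_pos hs) ?_
      (fun z hz => hb z (sphere_subset_closedBall hz))
    apply DifferentiableOn.diffContOnCl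
    exact hq'.mono (closure_ball_subset_closedBall.trans (closedBall_subset_ball (by linarith)))
  have hder : ∀ z ∈ ball a s, deriv f z = deriv q z * (f z - w) := by
    intro z hz
    rw [hqd z hz, deriv_sub_const, div_mul_cancel₀ _ (hne z hz)]
  have hdd : deriv (deriv f) a = (deriv (deriv q) a + deriv q a ^ 2) * (f a - w) := by
    have e1 : deriv f =ᶠ[nhds a] fun z => deriv q z * (f z - w) := by
      filter_upwards [isOpen_ball.mem_nhds haU] with z hz using hder z hz
    rw [e1.deriv_eq]
    have e2 := (hq'.differentiableAt (isOpen_ball.mem_nhds haU)).hasDerivAt.mul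
      ((hf.differentiableAt (isOpen_ball.mem_nhds haU)).hasDerivAt.sub_const w)
    have e3 := e2.deriv
    rw [hder a haU] at e3
    refine Eq.trans e3 ?_
    ring
  rw [hdd, norm_mul]
  have h3 : ‖deriv (deriv q) a + deriv q a ^ 2‖ ≤ (8 * K + K ^ 2) / s ^ 2 := by
    calc ‖deriv (deriv q) a + deriv q a ^ 2‖ ≤ ‖deriv (deriv q) a‖ + ‖deriv q a‖ ^ 2 := by
          refine (norm_add_le _ _).trans ?_
          rw [norm_pow]
      _ ≤ (2 * K / s) / (s / 2) + (K / s) ^ 2 := by gcongr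
      _ = (4 * K + K ^ 2) / s ^ 2 := by field_simp; ring
      _ ≤ (8 * K + K ^ 2) / s ^ 2 := by gcongr; linarith
  calc s * (‖deriv (deriv q) a + deriv q a ^ 2‖ * ‖f a - w‖)
      ≤ s * ((8 * K + K ^ 2) / s ^ 2 * (2 * s * ‖deriv f a‖)) := by gcongr
    _ = 2 * (8 * K + K ^ 2) * ‖deriv f a‖ := by field_simp

lemma parseval_series (c : ℕ → ℂ) (hc : Summable fun n => ‖c n‖) :
    HasSum (fun n => ‖c n‖ ^ 2) ((2 * Real.pi)⁻¹ *
      ∫ θ in (0 : ℝ)..2 * Real.pi, ‖∑' n, c n * exp (θ * I) ^ n‖ ^ 2) := by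
  have hsq : Summable fun n => ‖c n‖ ^ 2 := by
    refine Summable.of_nonneg_of_le (fun n => by positivity) (fun n => ?_)
      (hc.mul_left (∑' n, ‖c n‖))
    rw [sq]
    exact mul_le_mul_of_nonneg_right (hc.le_tsum n fun _ _ => norm_nonneg _) (norm_nonneg _)
  rw [hsq.hasSum_iff_tendsto_nat]
  have hfin : ∀ N : ℕ, ∑ i ∈ Finset.range N, ‖c i‖ ^ 2 = (2 * Real.pi)⁻¹ *
      ∫ θ in (0 : ℝ)..2 * Real.pi, ‖∑ i ∈ Finset.range N, c i * exp (θ * I) ^ i‖ ^ 2 := by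
    intro N
    set p : Polynomial ℂ := ∑ i ∈ Finset.range N, Polynomial.C (c i) * Polynomial.X ^ i with hp
    have hcoef : ∀ i, p.coeff i = if i < N then c i else 0 := by
      intro i
      simp [hp, Polynomial.coeff_X_pow]
    have h := Polynomial.sum_sq_norm_coeff_eq_circleAverage p
    rw [Real.circleAverage, smul_eq_mul] at h
    have hL : ∑ i ∈ p.support, ‖p.coeff i‖ ^ 2 = ∑ i ∈ Finset.range N, ‖c i‖ ^ 2 := by
      have hsub : p.support ⊆ Finset.range N := by
        intro i hi
        rw [Polynomial.mem_support_iff, hcoef] at hi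
        by_contra hcon
        exact hi (if_neg (by simpa using hcon))
      rw [Finset.sum_subset hsub (fun i _ hi => by
        rw [Polynomial.notMem_support_iff.1 hi]; simp)]
      refine Finset.sum_congr rfl fun i hi => ?_
      rw [hcoef, if_pos (Finset.mem_range.1 hi)]
    rw [← hL, h]
    congr 1
    refine intervalIntegral.integral_congr fun θ _ => ?_
    simp [hp, Polynomial.eval_finsetSum, circleMap]
  simp_rw [hfin]
  refine Tendsto.const_mul _ ?_
  have hnorm : ∀ (θ : ℝ) (i : ℕ), ‖c i * exp (θ * I) ^ i‖ = ‖c i‖ := by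
    intro θ i
    rw [norm_mul, norm_pow, Complex.norm_exp_ofReal_mul_I, one_pow, mul_one]
  refine intervalIntegral.tendsto_integral_filter_of_dominated_convergence
    (fun _ => (∑' n, ‖c n‖) ^ 2) ?_ ?_ ?_ ?_
  · refine Eventually.of_forall fun N => Continuous.aestronglyMeasurable ?_
    fun_prop
  · refine Eventually.of_forall fun N => Eventually.of_forall fun θ _ => ?_
    rw [Real.norm_eq_abs, abs_of_nonneg (by positivity)]
    gcongr
    calc ‖∑ i ∈ Finset.range N, c i * exp (θ * I) ^ i‖
        ≤ ∑ i ∈ Finset.range N, ‖c i * exp (θ * I) ^ i‖ := norm_sum_le _ _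
      _ = ∑ i ∈ Finset.range N, ‖c i‖ := Finset.sum_congr rfl fun i _ => hnorm θ i
      _ ≤ ∑' n, ‖c n‖ := hc.sum_le_tsum _ (fun i _ => norm_nonneg _)
  · exact intervalIntegrable_const
  · refine Eventually.of_forall fun θ _ => ?_
    have hs : Summable fun n => c n * exp (θ * I) ^ n := by
      refine Summable.of_norm ?_
      simpa only [hnorm θ] using hc
    exact (hs.hasSum.tendsto_sum_nat.norm).pow 2

/-- Parseval for a holomorphic function in the unit disc. -/
lemma parseval_disc {g : ℂ → ℂ} (hg : DifferentiableOn ℂ g (ball 0 1)) {r : ℝ} (hr0 : 0 ≤ r)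
    (hr1 : r < 1) :
    HasSum (fun n : ℕ => ‖iteratedDeriv n g 0 / (n.factorial : ℂ)‖ ^ 2 * (r ^ 2) ^ n)
      ((2 * Real.pi)⁻¹ * ∫ θ in (0 : ℝ)..2 * Real.pi, ‖g (r * exp (θ * I))‖ ^ 2) := by
  have key : ∀ z ∈ ball (0 : ℂ) 1,
      HasSum (fun n : ℕ => iteratedDeriv n g 0 / (n.factorial : ℂ) * z ^ n) (g z) := by
    intro z hz
    convert! Complex.hasSum_taylorSeries_on_ball hg hz using 2 with n
    simp only [smul_eq_mul, sub_zero]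
    ring
  have hrb : (r : ℂ) ∈ ball (0 : ℂ) 1 := by
    simpa [abs_of_nonneg hr0] using hr1
  have hsum := (key r hrb).summable.norm
  have h := parseval_series _ hsum
  convert! h using 1
  · ext n
    rw [norm_mul, norm_pow, Complex.norm_real, Real.norm_eq_abs, abs_of_nonneg hr0]
    ring
  · congr 1
    refine intervalIntegral.integral_congr fun θ _ => ?_
    have hz : (r : ℂ) * exp (θ * I) ∈ ball (0 : ℂ) 1 := by
      simpa [abs_of_nonneg hr0, Complex.norm_exp_ofReal_mul_I] using hr1
    have h2 := (key _ hz).tsum_eq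
    rw [← h2]
    simp only [mul_pow, mul_assoc]

/-- Growth of a nonnegative power series from a bound on its second-derivative-like series. -/
lemma series_growth {b : ℕ → ℝ} (hb : ∀ n, 0 ≤ b n) {K : ℝ} (hK : 0 ≤ K)
    (hs : ∀ x : ℝ, 0 ≤ x → x < 1 → Summable fun n => b n * x ^ n)
    (hs2 : ∀ x : ℝ, 0 ≤ x → x < 1 → Summable fun n : ℕ => (n : ℝ) ^ 2 * b n * x ^ n)
    (hbd : ∀ x : ℝ, 0 ≤ x → x < 1 → (1 - x) ^ 2 * ∑' n : ℕ, (n : ℝ) ^ 2 * b n * x ^ n ≤ K) :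
    ∃ A B : ℝ, 0 ≤ A ∧ 0 ≤ B ∧
      ∀ j : ℕ, ∑' n, b n * (Real.exp (-(1 / 2) ^ j)) ^ n ≤ A + B * j := by
  set F : ℝ → ℝ := fun x => ∑' n, b n * x ^ n with hF
  have step : ∀ y : ℝ, 0 ≤ y → y < 1 →
      F y - F (y ^ 2) ≤ (1 / 2) * (F (y ^ 2) - F ((y ^ 2) ^ 2)) + 3 / 2 * K := by
    intro y hy0 hy1
    have hy2 : y ^ 2 < 1 := by nlinarith
    have hy4 : (y ^ 2) ^ 2 < 1 := by nlinarith [sq_nonneg y]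
    have s1 := hs y hy0 hy1
    have s2 := hs (y ^ 2) (by positivity) hy2
    have s4 := hs ((y ^ 2) ^ 2) (by positivity) hy4
    have t := hs2 y hy0 hy1
    have hle : ∀ n : ℕ, b n * y ^ n - b n * (y ^ 2) ^ n ≤
        (1 / 2) * (b n * (y ^ 2) ^ n - b n * ((y ^ 2) ^ 2) ^ n) +
          3 / 2 * ((1 - y) ^ 2 * ((n : ℝ) ^ 2 * b n * y ^ n)) := by
      intro n
      set u := y ^ n with hu
      have hu0 : 0 ≤ u := by positivity
      have hu1 : u ≤ 1 := pow_le_one₀ hy0 hy1.le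
      have e2 : (y ^ 2) ^ n = u ^ 2 := by rw [hu]; ring
      have e4 : ((y ^ 2) ^ 2) ^ n = u ^ 4 := by rw [hu]; ring
      rw [e2, e4]
      have hbern : 1 - u ≤ n * (1 - y) := by
        have := one_add_mul_le_pow (a := y - 1) (by linarith) n
        rw [add_sub_cancel] at this
        rw [hu]; linarith
      have hsq : (1 - u) ^ 2 ≤ (n : ℝ) ^ 2 * (1 - y) ^ 2 := by
        rw [← mul_pow]
        exact pow_le_pow_left₀ (by linarith) hbern 2
      have h1 : u - u ^ 2 - 1 / 2 * (u ^ 2 - u ^ 4) ≤ 3 / 2 * ((n : ℝ) ^ 2 * (1 - y) ^ 2 * u) := by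
        have : u - u ^ 2 - 1 / 2 * (u ^ 2 - u ^ 4) = 1 / 2 * u * (1 - u) ^ 2 * (u + 2) := by ring
        rw [this]
        have h3 : 1 / 2 * u * (1 - u) ^ 2 * (u + 2) ≤ 1 / 2 * u * (1 - u) ^ 2 * 3 := by
          gcongr; linarith
        have h4 : u * (1 - u) ^ 2 ≤ u * ((n : ℝ) ^ 2 * (1 - y) ^ 2) := by gcongr
        linarith
      have := mul_le_mul_of_nonneg_left h1 (hb n)
      linarith
    have hT := Summable.tsum_le_tsum hle (s1.sub s2)
      (((s2.sub s4).mul_left _).add ((t.mul_left _).mul_left _))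
    rw [s1.tsum_sub s2, ((s2.sub s4).mul_left _).tsum_add ((t.mul_left _).mul_left _),
      tsum_mul_left, tsum_mul_left, tsum_mul_left, s2.tsum_sub s4] at hT
    have := hbd y hy0 hy1
    simp only [hF]
    linarith
  set x : ℕ → ℝ := fun j => Real.exp (-(1 / 2) ^ j) with hx
  have hx0 : ∀ j, 0 ≤ x j := fun j => (Real.exp_pos _).le
  have hx1 : ∀ j, x j < 1 := fun j => by
    rw [hx]; simp only; rw [Real.exp_lt_one_iff]
    have : (0 : ℝ) < (1 / 2) ^ j := by positivity
    linarith
  have hxs : ∀ j, x (j + 1) ^ 2 = x j := fun j => by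
    simp only [hx]
    rw [← Real.exp_nat_mul]
    congr 1
    push_cast
    ring
  set M : ℝ := max (F (x 1) - F (x 0)) (3 * K) with hM
  have hMK : 3 * K ≤ M := le_max_right _ _
  have hDb : ∀ j, F (x (j + 1)) - F (x j) ≤ M := by
    intro j
    induction j with
    | zero => exact le_max_left _ _
    | succ j ih =>
      have := step (x (j + 2)) (hx0 _) (hx1 _)
      rw [hxs (j + 1), hxs j] at this
      have e : x (j + 1 + 1) = x (j + 2) := rfl
      rw [e]
      linarith
  have hF0 : 0 ≤ F (x 0) := tsum_nonneg fun n => mul_nonneg (hb n) (pow_nonneg (hx0 0) n)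
  refine ⟨F (x 0), M, hF0, by linarith, fun j => ?_⟩
  show F (x j) ≤ _
  induction j with
  | zero => simp
  | succ j ih =>
    have := hDb j
    push_cast
    linarith

/-- Second moment growth for a Bloch function. -/
lemma bloch_mean {g : ℂ → ℂ} (hg : DifferentiableOn ℂ g (ball 0 1)) {C : ℝ}
    (hC : ∀ z ∈ ball (0 : ℂ) 1, (1 - ‖z‖) * ‖deriv g z‖ ≤ C) :
    ∃ A B : ℝ, 0 ≤ A ∧ 0 ≤ B ∧ ∀ m : ℕ,
      ∫ θ in (0 : ℝ)..2 * Real.pi, ‖g (((1 - Real.exp (-m) : ℝ) : ℂ) * exp (θ * I))‖ ^ 2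
        ≤ A + B * m := by
  have hC0 : 0 ≤ C := le_trans (by simp) (hC 0 (mem_ball_self one_pos))
  set b : ℕ → ℝ := fun n => ‖iteratedDeriv n g 0 / (n.factorial : ℂ)‖ ^ 2 with hbdef
  have hb : ∀ n, 0 ≤ b n := fun n => by positivity
  have hs : ∀ x : ℝ, 0 ≤ x → x < 1 → Summable fun n => b n * x ^ n := by
    intro x hx0 hx1
    have h := parseval_disc hg (Real.sqrt_nonneg x) ((Real.sqrt_lt' one_pos).2 (by simpa using hx1))
    rw [Real.sq_sqrt hx0] at h
    exact h.summable
  have h2 : ∀ x : ℝ, 0 ≤ x → x < 1 → HasSum (fun n : ℕ => (n : ℝ) ^ 2 * b n * x ^ n)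
      (x * ((2 * Real.pi)⁻¹ * ∫ θ in (0 : ℝ)..2 * Real.pi,
        ‖deriv g ((Real.sqrt x : ℝ) * exp (θ * I))‖ ^ 2)) := by
    intro x hx0 hx1
    have h := parseval_disc (hg.deriv isOpen_ball) (Real.sqrt_nonneg x)
      ((Real.sqrt_lt' one_pos).2 (by simpa using hx1))
    rw [Real.sq_sqrt hx0] at h
    have h' := h.mul_left x
    rw [← hasSum_nat_add_iff' 1]
    simp only [Finset.range_one, Finset.sum_singleton, Nat.cast_zero, ne_eq, OfNat.ofNat_ne_zero,
      not_false_eq_true, zero_pow, zero_mul, sub_zero]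
    convert! h' using 1
    ext n
    simp only [hbdef]
    rw [iteratedDeriv_succ', Nat.factorial_succ, norm_div, norm_div]
    push_cast
    rw [norm_mul]
    have e : ‖(n : ℂ) + 1‖ = (n : ℝ) + 1 := by
      have : ((n : ℂ) + 1) = ((n + 1 : ℕ) : ℂ) := by push_cast; rfl
      rw [this, Complex.norm_natCast]; push_cast; rfl
    rw [e]
    have hn : (n : ℝ) + 1 ≠ 0 := by positivity
    have hf : ‖(n.factorial : ℂ)‖ ≠ 0 := by
      rw [norm_ne_zero_iff]; exact_mod_cast n.factorial_ne_zero
    field_simp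
    ring
  have hbd : ∀ x : ℝ, 0 ≤ x → x < 1 →
      (1 - x) ^ 2 * ∑' n : ℕ, (n : ℝ) ^ 2 * b n * x ^ n ≤ 4 * C ^ 2 := by
    intro x hx0 hx1
    rw [(h2 x hx0 hx1).tsum_eq]
    set r := Real.sqrt x with hr
    have hr0 : 0 ≤ r := Real.sqrt_nonneg x
    have hr1 : r < 1 := (Real.sqrt_lt' one_pos).2 (by simpa using hx1)
    have hxr : x = r ^ 2 := (Real.sq_sqrt hx0).symm
    have hpt : ∀ θ : ℝ, ‖‖deriv g ((r : ℝ) * exp (θ * I))‖ ^ 2‖ ≤ (C / (1 - r)) ^ 2 := by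
      intro θ
      have hn : ‖(r : ℂ) * exp (θ * I)‖ = r := by
        simp [abs_of_nonneg hr0, Complex.norm_exp_ofReal_mul_I]
      have h := hC ((r : ℂ) * exp (θ * I)) (by rw [mem_ball_zero_iff, hn]; exact hr1)
      rw [hn] at h
      rw [Real.norm_eq_abs, abs_of_nonneg (by positivity)]
      have : ‖deriv g ((r : ℝ) * exp (θ * I))‖ ≤ C / (1 - r) := by
        rw [le_div_iff₀ (by linarith)]; linarith
      gcongr
    have hI := intervalIntegral.norm_integral_le_of_norm_le_const (a := 0) (b := 2 * Real.pi)
      (fun θ _ => hpt θ)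
    rw [sub_zero, abs_of_pos Real.two_pi_pos] at hI
    have hI' := (Real.le_norm_self _).trans hI
    set J := ∫ θ in (0 : ℝ)..2 * Real.pi, ‖deriv g ((r : ℝ) * exp (θ * I))‖ ^ 2 with hJ
    have hJ0 : 0 ≤ J := intervalIntegral.integral_nonneg Real.two_pi_pos.le
      (fun θ _ => by positivity)
    have h3 : (2 * Real.pi)⁻¹ * J ≤ (C / (1 - r)) ^ 2 := by
      rw [inv_mul_le_iff₀ Real.two_pi_pos]; linarith
    have h1r : 0 < 1 - r := by linarith
    calc (1 - x) ^ 2 * (x * ((2 * Real.pi)⁻¹ * J))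
        ≤ (1 - x) ^ 2 * (1 * (C / (1 - r)) ^ 2) := by gcongr
      _ = (1 + r) ^ 2 * C ^ 2 := by rw [hxr]; field_simp; ring
      _ ≤ 4 * C ^ 2 := by
        gcongr
        nlinarith
  obtain ⟨A, B, hA, hB, hAB⟩ := series_growth hb (by positivity) hs
    (fun x hx0 hx1 => (h2 x hx0 hx1).summable) hbd
  refine ⟨2 * Real.pi * A, 2 * Real.pi * (B * 2), by positivity, by positivity, fun m => ?_⟩
  set r : ℝ := 1 - Real.exp (-m) with hr
  have hr0 : 0 ≤ r := by
    have : Real.exp (-(m : ℝ)) ≤ 1 := Real.exp_le_one_iff.2 (by simp)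
    linarith
  have hr1 : r < 1 := by have := Real.exp_pos (-(m : ℝ)); linarith
  have hP := parseval_disc hg hr0 hr1
  set J := ∫ θ in (0 : ℝ)..2 * Real.pi, ‖g ((r : ℂ) * exp (θ * I))‖ ^ 2 with hJ
  set y : ℝ := Real.exp (-(1 / 2) ^ (2 * m)) with hy
  have hry : r ^ 2 ≤ y := by
    have h1 : r ^ 2 ≤ r := by nlinarith
    have h3 : 1 - (1 / 2 : ℝ) ^ (2 * m) ≤ y := by
      have := Real.add_one_le_exp (-(1 / 2 : ℝ) ^ (2 * m))
      linarith
    have h4 : (1 / 2 : ℝ) ^ (2 * m) ≤ Real.exp (-m) := by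
      rw [pow_mul, show -(m : ℝ) = (m : ℝ) * (-1) by ring, Real.exp_nat_mul]
      gcongr
      rw [Real.exp_neg]
      have : Real.exp 1 < 4 := by linarith [Real.exp_one_lt_d9]
      rw [show ((1 : ℝ) / 2) ^ 2 = (4 : ℝ)⁻¹ by norm_num]
      exact inv_anti₀ (Real.exp_pos 1) this.le
    linarith
  have hy1 : y < 1 := by
    rw [hy, Real.exp_lt_one_iff]
    have : (0 : ℝ) < (1 / 2) ^ (2 * m) := by positivity
    linarith
  have hle : (2 * Real.pi)⁻¹ * J ≤ A + B * ((2 * m : ℕ) : ℝ) := by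
    rw [← hP.tsum_eq]
    refine le_trans ?_ (hAB (2 * m))
    refine Summable.tsum_le_tsum (fun n => ?_) hP.summable (hs y (Real.exp_pos _).le hy1)
    exact mul_le_mul_of_nonneg_left (pow_le_pow_left₀ (by positivity) hry n) (hb n)
  rw [inv_mul_le_iff₀ Real.two_pi_pos] at hle
  push_cast at hle
  linarith

lemma bloch_ae_sparse {g : ℂ → ℂ} (hg : DifferentiableOn ℂ g (ball 0 1)) {C : ℝ}
    (hC : ∀ z ∈ ball (0 : ℂ) 1, (1 - ‖z‖) * ‖deriv g z‖ ≤ C) :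
    ∀ᵐ (θ : ℝ) ∂(volume.restrict (Set.Ico (0 : ℝ) (2 * Real.pi))),
      Tendsto (fun k : ℕ => ‖g (((1 - Real.exp (-((k ^ 2 : ℕ) : ℝ)) : ℝ) : ℂ) * exp (θ * I))‖ /
        (k : ℝ) ^ 2) atTop (nhds 0) := by
  obtain ⟨A, B, hA, hB, hAB⟩ := bloch_mean hg hC
  set r : ℕ → ℝ := fun k => 1 - Real.exp (-((k ^ 2 : ℕ) : ℝ)) with hr
  have hr0 : ∀ k, 0 ≤ r k := fun k => by
    have : Real.exp (-((k ^ 2 : ℕ) : ℝ)) ≤ 1 :=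
      Real.exp_le_one_iff.2 (neg_nonpos.2 (Nat.cast_nonneg _))
    simp only [hr]; linarith
  have hr1 : ∀ k, r k < 1 := fun k => by
    have := Real.exp_pos (-((k ^ 2 : ℕ) : ℝ))
    simp only [hr]; linarith
  have hcont : ∀ k, Continuous fun θ : ℝ => g ((r k : ℂ) * exp (θ * I)) := by
    intro k
    refine hg.continuousOn.comp_continuous (by fun_prop) fun θ => ?_
    have hn : ‖(r k : ℂ) * exp (θ * I)‖ = r k := by
      simp [abs_of_nonneg (hr0 k), Complex.norm_exp_ofReal_mul_I]
    rw [mem_ball_zero_iff, hn]; exact hr1 k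
  set φ : ℕ → ℝ → ℝ := fun k θ => (‖g ((r k : ℂ) * exp (θ * I))‖ / (k : ℝ) ^ 2) ^ 2 with hφ
  have hφc : ∀ k, Continuous (φ k) := fun k => ((hcont k).norm.div_const _).pow 2
  set μ := volume.restrict (Set.Ico (0 : ℝ) (2 * Real.pi)) with hμ
  have hint : ∀ k, ∫⁻ θ, ENNReal.ofReal (φ k θ) ∂μ ≤
      ENNReal.ofReal ((A + B) * (1 / (k : ℝ) ^ 2)) := by
    intro k
    have hi : Integrable (φ k) μ := by
      have h1 : IntegrableOn (φ k) (Set.Icc 0 (2 * Real.pi)) :=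
        (hφc k).continuousOn.integrableOn_compact isCompact_Icc
      exact h1.mono_set Set.Ico_subset_Icc_self
    rw [← ofReal_integral_eq_lintegral_ofReal hi (Eventually.of_forall fun θ => by positivity)]
    apply ENNReal.ofReal_le_ofReal
    have e1 : ∫ θ, φ k θ ∂μ = ∫ θ in (0 : ℝ)..2 * Real.pi, φ k θ := by
      rw [intervalIntegral.integral_of_le Real.two_pi_pos.le, hμ,
        integral_Ico_eq_integral_Ioc]
    have e2 : ∫ θ in (0 : ℝ)..2 * Real.pi, φ k θ = (1 / (k : ℝ) ^ 4) *
        ∫ θ in (0 : ℝ)..2 * Real.pi, ‖g ((r k : ℂ) * exp (θ * I))‖ ^ 2 := by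
      rw [← intervalIntegral.integral_const_mul]
      refine intervalIntegral.integral_congr fun θ _ => ?_
      simp only [hφ]
      rw [div_pow]
      ring
    rw [e1, e2]
    rcases Nat.eq_zero_or_pos k with rfl | hk
    · simp
    have hk1 : (1 : ℝ) ≤ k := by exact_mod_cast hk
    have h := hAB (k ^ 2)
    have hkk : A + B * ((k ^ 2 : ℕ) : ℝ) ≤ (A + B) * (k : ℝ) ^ 2 := by
      push_cast
      have hk2 : (1 : ℝ) ≤ (k : ℝ) ^ 2 := one_le_pow₀ hk1
      have := le_mul_of_one_le_right hA hk2
      linarith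
    calc (1 / (k : ℝ) ^ 4) * ∫ θ in (0 : ℝ)..2 * Real.pi, ‖g ((r k : ℂ) * exp (θ * I))‖ ^ 2
        ≤ (1 / (k : ℝ) ^ 4) * ((A + B) * (k : ℝ) ^ 2) := by
          gcongr
          exact h.trans hkk
      _ = (A + B) * (1 / (k : ℝ) ^ 2) := by field_simp
  have hsum : ∑' k, ∫⁻ θ, ENNReal.ofReal (φ k θ) ∂μ ≠ ⊤ := by
    have hS : Summable fun k : ℕ => (A + B) * (1 / (k : ℝ) ^ 2) :=
      (Real.summable_one_div_nat_pow.2 one_lt_two).mul_left _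
    refine ne_top_of_le_ne_top ?_ (ENNReal.tsum_le_tsum hint)
    rw [← ENNReal.ofReal_tsum_of_nonneg (fun k => by positivity) hS]
    exact ENNReal.ofReal_ne_top
  have hmeas : ∀ k, Measurable fun θ => ENNReal.ofReal (φ k θ) := fun k =>
    (hφc k).measurable.ennreal_ofReal
  rw [← lintegral_tsum fun k => (hmeas k).aemeasurable] at hsum
  filter_upwards [ae_lt_top (Measurable.tsum hmeas) hsum] with θ hθ
  have h1 := ENNReal.tendsto_atTop_zero_of_tsum_ne_top hθ.ne
  have h2 := (ENNReal.tendsto_toReal ENNReal.zero_ne_top).comp h1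
  have h3 : Tendsto (fun k => φ k θ) atTop (nhds 0) := by
    refine Tendsto.congr (fun k => ?_) h2
    exact ENNReal.toReal_ofReal (by positivity)
  have h4 := (Real.continuous_sqrt.tendsto 0).comp h3
  rw [Real.sqrt_zero] at h4
  refine Tendsto.congr (fun k => ?_) h4
  simp only [Function.comp, hφ]
  exact Real.sqrt_sq (by positivity)

lemma bloch_radial {g : ℂ → ℂ} (hg : DifferentiableOn ℂ g (ball 0 1)) {C : ℝ}
    (hC : ∀ z ∈ ball (0 : ℂ) 1, (1 - ‖z‖) * ‖deriv g z‖ ≤ C) {ζ : ℂ} (hζ : ‖ζ‖ = 1)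
    {r₀ r : ℝ} (h0 : 0 ≤ r₀) (hle : r₀ ≤ r) (hr : r < 1) :
    ‖g (r * ζ)‖ ≤ ‖g (r₀ * ζ)‖ + C * (Real.log (1 - r₀) - Real.log (1 - r)) := by
  have hn : ∀ t : ℝ, 0 ≤ t → ‖(t : ℂ) * ζ‖ = t := fun t ht => by
    rw [norm_mul, hζ, mul_one, Complex.norm_real, Real.norm_eq_abs, abs_of_nonneg ht]
  have hm : ∀ t ∈ Set.Icc r₀ r, (t : ℂ) * ζ ∈ ball (0 : ℂ) 1 := fun t ht => by
    rw [mem_ball_zero_iff, hn t (h0.trans ht.1)]; exact ht.2.trans_lt hr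
  have hd : ∀ t ∈ Set.Icc r₀ r,
      HasDerivAt (fun t : ℝ => g (t * ζ)) (deriv g (t * ζ) * ζ) t := by
    intro t ht
    have h1 := (hg.differentiableAt (isOpen_ball.mem_nhds (hm t ht))).hasDerivAt
    have h2 : HasDerivAt (fun t : ℝ => (t : ℂ) * ζ) ζ t := by
      simpa using (Complex.ofRealCLM.hasDerivAt (x := t)).mul_const ζ
    exact h1.comp t h2
  have hB : ∀ t ∈ Set.Icc r₀ r, HasDerivAt
      (fun t : ℝ => ‖g (r₀ * ζ)‖ + C * (Real.log (1 - r₀) - Real.log (1 - t))) (C / (1 - t)) t := by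
    intro t ht
    have hpos : 0 < 1 - t := by have := ht.2; linarith
    have h1 := ((hasDerivAt_id t).const_sub 1).log hpos.ne'
    have h2 := ((h1.const_sub (Real.log (1 - r₀))).const_mul C).const_add ‖g (r₀ * ζ)‖
    convert! h2 using 1
    simp only [id]
    ring
  refine image_norm_le_of_norm_deriv_right_le_deriv_boundary' (a := r₀) (b := r)
    (f := fun t : ℝ => g (t * ζ)) (f' := fun t : ℝ => deriv g (t * ζ) * ζ)
    (B := fun t => ‖g (r₀ * ζ)‖ + C * (Real.log (1 - r₀) - Real.log (1 - t)))
    (B' := fun t => C / (1 - t))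
    (fun t ht => (hd t ht).continuousAt.continuousWithinAt)
    (fun t ht => (hd t (Set.Ico_subset_Icc_self ht)).hasDerivWithinAt) (by simp)
    (fun t ht => (hB t ht).continuousAt.continuousWithinAt)
    (fun t ht => (hB t (Set.Ico_subset_Icc_self ht)).hasDerivWithinAt) ?_ ⟨hle, le_rfl⟩
  intro t ht
  have ht' := Set.Ico_subset_Icc_self ht
  have h := hC _ (hm t ht')
  rw [hn t (h0.trans ht.1)] at h
  have hpos : 0 < 1 - t := by have := ht.2; linarith
  rw [norm_mul, hζ, mul_one, le_div_iff₀ hpos]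
  linarith

lemma bloch_ae {g : ℂ → ℂ} (hg : DifferentiableOn ℂ g (ball 0 1)) {C : ℝ}
    (hC : ∀ z ∈ ball (0 : ℂ) 1, (1 - ‖z‖) * ‖deriv g z‖ ≤ C) :
    ∀ᵐ (θ : ℝ) ∂(volume.restrict (Set.Ico (0 : ℝ) (2 * Real.pi))),
      Tendsto (fun r : ℝ => ‖g (r * exp (θ * I))‖ / (-Real.log (1 - r)))
        (nhdsWithin 1 (Set.Iio 1)) (nhds 0) := by
  have hC0 : 0 ≤ C := le_trans (by simp) (hC 0 (mem_ball_self one_pos))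
  filter_upwards [bloch_ae_sparse hg hC] with θ hθ
  have hL : Tendsto (fun r : ℝ => -Real.log (1 - r)) (nhdsWithin 1 (Set.Iio 1)) atTop := by
    refine tendsto_neg_atBot_atTop.comp (Real.tendsto_log_nhdsGT_zero.comp ?_)
    refine tendsto_nhdsWithin_iff.2 ⟨?_, ?_⟩
    · have : Tendsto (fun r : ℝ => 1 - r) (nhds 1) (nhds (1 - 1)) :=
        tendsto_const_nhds.sub tendsto_id
      rw [sub_self] at this
      exact this.mono_left nhdsWithin_le_nhds
    · filter_upwards [self_mem_nhdsWithin] with r hr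
      exact sub_pos.2 (Set.mem_Iio.1 hr)
  set κ : ℝ → ℕ := fun r => ⌊Real.sqrt (-Real.log (1 - r))⌋₊ with hκ
  have hκt : Tendsto κ (nhdsWithin 1 (Set.Iio 1)) atTop :=
    tendsto_nat_floor_atTop.comp (Real.tendsto_sqrt_atTop.comp hL)
  have hinv : Tendsto (fun k : ℕ => 3 * C * (1 / (k : ℝ))) atTop (nhds 0) := by
    simpa using tendsto_one_div_atTop_nhds_zero_nat.const_mul (3 * C)
  have hup := (hθ.add hinv).comp hκt
  rw [add_zero] at hup
  refine tendsto_of_tendsto_of_tendsto_of_le_of_le' tendsto_const_nhds hup ?_ ?_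
  · filter_upwards [hL.eventually_ge_atTop 0] with r hr
    positivity
  · filter_upwards [hL.eventually_ge_atTop 1, hκt.eventually_ge_atTop 1, self_mem_nhdsWithin]
      with r hr hk hr1
    simp only [Function.comp]
    have hr1' : r < 1 := hr1
    set L := -Real.log (1 - r) with hLd
    set k := κ r with hkd
    have hk1 : (1 : ℝ) ≤ k := by exact_mod_cast hk
    have hkL : (k : ℝ) ^ 2 ≤ L := by
      have h1 : (k : ℝ) ≤ Real.sqrt L := Nat.floor_le (Real.sqrt_nonneg _)
      calc (k : ℝ) ^ 2 ≤ Real.sqrt L ^ 2 := by gcongr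
        _ = L := Real.sq_sqrt (by linarith)
    have hLk : L ≤ ((k : ℝ) + 1) ^ 2 := by
      have h1 : Real.sqrt L ≤ k + 1 := (Nat.lt_floor_add_one _).le
      calc L = Real.sqrt L ^ 2 := (Real.sq_sqrt (by linarith)).symm
        _ ≤ _ := by gcongr
    set r₀ : ℝ := 1 - Real.exp (-((k ^ 2 : ℕ) : ℝ)) with hr₀
    have hr₀0 : 0 ≤ r₀ := by
      have : Real.exp (-((k ^ 2 : ℕ) : ℝ)) ≤ 1 :=
        Real.exp_le_one_iff.2 (neg_nonpos.2 (Nat.cast_nonneg _))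
      linarith
    have hlog : Real.log (1 - r₀) = -(k : ℝ) ^ 2 := by
      rw [hr₀, sub_sub_cancel, Real.log_exp]; push_cast; rfl
    have hrr : r₀ ≤ r := by
      have h1 : 1 - r = Real.exp (-L) := by
        rw [hLd, neg_neg, Real.exp_log (by linarith)]
      have h2 : Real.exp (-L) ≤ Real.exp (-((k ^ 2 : ℕ) : ℝ)) := by
        apply Real.exp_le_exp.2
        push_cast
        linarith
      linarith
    have hb := bloch_radial hg hC (ζ := exp (θ * I)) (Complex.norm_exp_ofReal_mul_I θ)
      hr₀0 hrr hr1'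
    rw [hlog] at hb
    have hkpos : (0 : ℝ) < (k : ℝ) ^ 2 := by positivity
    have hb2 : ‖g (r * exp (θ * I))‖ ≤ ‖g (r₀ * exp (θ * I))‖ + C * (3 * k) := by
      refine hb.trans ?_
      gcongr
      nlinarith
    calc ‖g (r * exp (θ * I))‖ / L ≤ (‖g (r₀ * exp (θ * I))‖ + C * (3 * k)) / (k : ℝ) ^ 2 := by
          gcongr
      _ = ‖g (r₀ * exp (θ * I))‖ / (k : ℝ) ^ 2 + 3 * C * (1 / (k : ℝ)) := by
          field_simp

/-- **Almost-everywhere radial sub-power growth of `log |R′|`.** For a univalent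
(injective holomorphic) map `R` on the unit disc, for Lebesgue-a.e.
`θ ∈ [0, 2π)`, `lim_{r→1⁻} log |R′(r e^{iθ})| / log (1 - r) = 0`. -/
theorem radial_log_deriv_over_log_one_sub_tendsto_zero (R : ℂ → ℂ)
    (hR : DifferentiableOn ℂ R (ball (0 : ℂ) 1))
    (hinj : Set.InjOn R (ball (0 : ℂ) 1)) :
    ∀ᵐ (θ : ℝ) ∂(volume.restrict (Set.Ico (0 : ℝ) (2 * Real.pi))),
      Tendsto (fun r : ℝ =>
          Real.log ‖deriv R ((r : ℂ) * Complex.exp ((θ : ℂ) * Complex.I))‖ /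
            Real.log (1 - r))
        (nhdsWithin 1 (Set.Iio 1)) (nhds 0) := by
  obtain ⟨C, hC0, hC⟩ := univalent_preschwarzian
  have hne : ∀ z ∈ ball (0 : ℂ) 1, deriv R z ≠ 0 := fun z hz =>
    univalent_deriv_ne_zero one_pos hR hinj hz
  obtain ⟨g, hg, hexp, hgd⟩ := exists_holo_log one_pos (hR.deriv isOpen_ball) hne
  have hbl : ∀ z ∈ ball (0 : ℂ) 1, (1 - ‖z‖) * ‖deriv g z‖ ≤ C := by
    intro z hz
    have hz1 : ‖z‖ < 1 := mem_ball_zero_iff.1 hz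
    have hsub : ball z (1 - ‖z‖) ⊆ ball (0 : ℂ) 1 := ball_subset_ball' (by
      rw [dist_zero_right]; linarith)
    have h := hC R z (1 - ‖z‖) (by linarith) (hR.mono hsub) (hinj.mono hsub)
    rw [hgd z hz, norm_div, ← mul_div_assoc, div_le_iff₀ (norm_pos_iff.2 (hne z hz))]
    exact h
  filter_upwards [bloch_ae hg hbl] with θ hθ
  refine squeeze_zero_norm' ?_ hθ
  have h0 : Set.Ioo (0 : ℝ) 1 ∈ nhdsWithin (1 : ℝ) (Set.Iio 1) := Ioo_mem_nhdsLT one_pos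
  filter_upwards [h0] with r hr
  have hz : (r : ℂ) * exp (θ * I) ∈ ball (0 : ℂ) 1 := by
    rw [mem_ball_zero_iff, norm_mul, Complex.norm_exp_ofReal_mul_I, mul_one, Complex.norm_real,
      Real.norm_eq_abs, abs_of_pos hr.1]
    exact hr.2
  have hlog : Real.log (1 - r) < 0 := Real.log_neg (by linarith [hr.2]) (by linarith [hr.1])
  rw [norm_div, Real.norm_eq_abs (Real.log (1 - r)), abs_of_neg hlog, hexp _ hz,
    Complex.norm_exp, Real.log_exp]
  have hpos : 0 < -Real.log (1 - r) := by linarith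
  gcongr
  exact Complex.abs_re_le_norm _
end

section
/- There exists a finite universal constant C_M such that for every holomorphic injective map R : 𝔻 → ℂ on the open unit disc, for Lebesgue-almost every θ ∈ [0,2π), limsup_{r→1⁻} |log|R′(r·e^{iθ})|| / √( log(1/(1−r)) · log log log(1/(1−r)) ) ≤ C_M. -/
open Metric Complex MeasureTheory Filter

/-- Bloch condition on the upper half-plane. -/
def HPBloch (g : ℂ → ℂ) (B : ℝ) : Prop :=
  0 ≤ B ∧ ∀ w : ℂ, 0 < w.im → DifferentiableAt ℂ g w ∧ ‖deriv g w‖ ≤ B / w.im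

lemma HPBloch.horiz {g : ℂ → ℂ} {B : ℝ} (hg : HPBloch g B) {w₁ w₂ : ℂ} {l : ℝ} (hl : 0 < l)
    (h1 : l ≤ w₁.im) (h2 : l ≤ w₂.im) : ‖g w₂ - g w₁‖ ≤ B / l * ‖w₂ - w₁‖ := by
  have hs : Convex ℝ {w : ℂ | l ≤ w.im} := convex_halfSpace_im_ge l
  refine hs.norm_image_sub_le_of_norm_deriv_le (f := g) (fun w hw => ?_) (fun w hw => ?_) h1 h2
  · exact (hg.2 w (lt_of_lt_of_le hl hw)).1
  · have hw' : l ≤ w.im := hw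
    refine (hg.2 w (lt_of_lt_of_le hl hw)).2.trans ?_
    have := hg.1
    gcongr

lemma HPBloch.vert {g : ℂ → ℂ} {B : ℝ} (hg : HPBloch g B) (x : ℝ) {y l : ℝ} (hy : 0 < y)
    (hl : y ≤ l) : ‖g (x + l * I) - g (x + y * I)‖ ≤ B * (Real.log l - Real.log y) := by
  have key : ∀ t : ℝ, 0 < t →
      HasDerivAt (fun t : ℝ => g (x + t * I) - g (x + y * I)) (deriv g (x + t * I) * I) t := by
    intro t ht
    have h1 := (hg.2 (x + t * I) (by simpa using ht)).1.hasDerivAt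
    have h2 : HasDerivAt (fun t : ℝ => ((x : ℂ) + t * I)) I t := by
      have := ((hasDerivAt_id t).ofReal_comp.mul_const I).const_add (x : ℂ)
      simpa using! this
    have h3 := HasDerivAt.scomp t h1 h2
    simpa [mul_comm] using! h3.sub_const (g (x + y * I))
  refine image_norm_le_of_norm_deriv_right_le_deriv_boundary' (a := y) (b := l)
    (f := fun t : ℝ => g (x + t * I) - g (x + y * I)) (f' := fun t => deriv g (x + t * I) * I)
    (B := fun t => B * (Real.log t - Real.log y)) (B' := fun t => B * t⁻¹) ?_ ?_ ?_ ?_ ?_ ?_ ⟨hl, le_rfl⟩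
  · intro t ht
    exact (key t (hy.trans_le ht.1)).continuousAt.continuousWithinAt
  · intro t ht
    exact (key t (hy.trans_le ht.1)).hasDerivWithinAt
  · simp
  · intro t ht
    have : t ≠ 0 := (hy.trans_le ht.1).ne'
    exact (continuousAt_const.mul ((Real.continuousAt_log this).sub continuousAt_const)).continuousWithinAt
  · intro t ht
    have : t ≠ 0 := (hy.trans_le ht.1).ne'
    exact (((Real.hasDerivAt_log this).sub_const _).const_mul B).hasDerivWithinAt
  · intro t ht
    have := (hg.2 (x + t * I) (by simpa using hy.trans_le ht.1)).2
    simpa [div_eq_mul_inv] using this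

/-- Horizontal average at height `δ` over `[x₀, x₀ + l]`. -/
noncomputable def hAvg (g : ℂ → ℂ) (δ x₀ l : ℝ) : ℂ :=
  (∫ x : ℝ in x₀..(x₀ + l), g (x + δ * I)) / l

lemma HPBloch.contH {g : ℂ → ℂ} {B : ℝ} (hg : HPBloch g B) {δ : ℝ} (hδ : 0 < δ) :
    Continuous (fun x : ℝ => g (x + δ * I)) := by
  rw [continuous_iff_continuousAt]
  intro x
  have h := (hg.2 (x + δ * I) (by simpa using hδ)).1.continuousAt
  exact ContinuousAt.comp (f := fun x : ℝ => (x + δ * I : ℂ)) h (by fun_prop)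

lemma HPBloch.contV {g : ℂ → ℂ} {B : ℝ} (hg : HPBloch g B) (x : ℝ) :
    ContinuousOn (fun y : ℝ => g (x + y * I)) (Set.Ioi 0) := by
  intro y hy
  have h := (hg.2 (x + y * I) (by simpa using hy)).1.continuousAt
  exact (ContinuousAt.comp (f := fun y : ℝ => (x + y * I : ℂ)) h (by fun_prop)).continuousWithinAt

lemma HPBloch.avg_half {g : ℂ → ℂ} {B : ℝ} (hg : HPBloch g B) {δ : ℝ} (hδ : 0 < δ) (x₀ : ℝ) {l : ℝ}
    (hl : 0 < l) :
    hAvg g δ x₀ (2 * l) = (hAvg g δ x₀ l + hAvg g δ (x₀ + l) l) / 2 := by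
  have hc := hg.contH hδ
  unfold hAvg
  rw [← intervalIntegral.integral_add_adjacent_intervals (b := x₀ + l)
    (hc.intervalIntegrable _ _) (hc.intervalIntegrable _ _)]
  have : (l : ℂ) ≠ 0 := by exact_mod_cast hl.ne'
  have e : x₀ + l + l = x₀ + 2 * l := by ring
  rw [e]
  push_cast
  field_simp

lemma HPBloch.avg_close {g : ℂ → ℂ} {B : ℝ} (hg : HPBloch g B) {δ : ℝ} (hδ : 0 < δ) {x₀ l x : ℝ}
    (hl : δ ≤ l) (hx : x ∈ Set.Icc x₀ (x₀ + l)) :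
    ‖hAvg g δ x₀ l - g (x + l * I)‖ ≤ 4 * B := by
  have hl0 : 0 < l := hδ.trans_le hl
  have hB := hg.1
  have hc := hg.contH hδ
  have hcl := hg.contH hl0
  -- rectangle
  have hrect := Complex.integral_boundary_rect_eq_zero_of_differentiableOn g
    (x₀ + δ * I) ((x₀ + l : ℝ) + l * I) (by
      intro w hw
      have : w.im ∈ Set.uIcc δ l := by simpa using hw.2
      rw [Set.uIcc_of_le hl] at this
      exact (hg.2 w (hδ.trans_le this.1)).1.differentiableWithinAt)
  simp only [add_re, ofReal_re, mul_re, I_re, mul_zero, ofReal_im, I_im, mul_one, sub_self, add_zero,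
    add_im, mul_im, zero_add] at hrect
  have hV : ∀ x : ℝ, IntervalIntegrable (fun y : ℝ => g (x + y * I)) volume δ l := fun x =>
    ((hg.contV x).mono (by
      rw [Set.uIcc_of_le hl]; intro y hy; exact hδ.trans_le hy.1)).intervalIntegrable
  have hlogint : IntervalIntegrable (fun y : ℝ => B + 2 * (B * (Real.log l - Real.log y))) volume δ l := by
    apply ContinuousOn.intervalIntegrable
    rw [Set.uIcc_of_le hl]
    intro y hy
    have : y ≠ 0 := (hδ.trans_le hy.1).ne'
    exact (continuousAt_const.add (continuousAt_const.mul (continuousAt_const.mul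
      (continuousAt_const.sub (Real.continuousAt_log this))))).continuousWithinAt
  have h1 : ‖(∫ y : ℝ in δ..l, g ((x₀ + l : ℝ) + y * I)) - ∫ y : ℝ in δ..l, g (x₀ + y * I)‖ ≤ 3 * B * l := by
    rw [← intervalIntegral.integral_sub (hV _) (hV _)]
    refine (intervalIntegral.norm_integral_le_of_norm_le hl (g := fun y => B + 2 * (B * (Real.log l - Real.log y)))
      (Eventually.of_forall fun y hy => ?_) hlogint).trans ?_
    · have a1 := hg.vert (x₀ + l) (hδ.trans hy.1) hy.2
      have a2 := hg.vert x₀ (hδ.trans hy.1) hy.2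
      have a3 := hg.horiz (w₁ := x₀ + l * I) (w₂ := (x₀ + l : ℝ) + l * I) hl0 (by simp) (by simp)
      have a4 : ‖(((x₀ + l : ℝ) + l * I) - (x₀ + l * I) : ℂ)‖ = l := by
        have : (((x₀ + l : ℝ) + l * I) - (x₀ + l * I) : ℂ) = (l : ℂ) := by push_cast; ring
        rw [this]; simp [abs_of_pos hl0]
      rw [a4, div_mul_cancel₀ _ hl0.ne'] at a3
      have : g ((x₀ + l : ℝ) + y * I) - g (x₀ + y * I) =
        (g ((x₀ + l : ℝ) + l * I) - g (x₀ + l * I)) - (g ((x₀ + l : ℝ) + l * I) - g ((x₀ + l : ℝ) + y * I))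
        + (g (x₀ + l * I) - g (x₀ + y * I)) := by ring
      rw [this]
      refine (norm_add_le _ _).trans ?_
      have := norm_sub_le (g ((x₀ + l : ℝ) + l * I) - g (x₀ + l * I)) (g ((x₀ + l : ℝ) + l * I) - g ((x₀ + l : ℝ) + y * I))
      linarith
    · have e : ∫ y in δ..l, (B + 2 * (B * (Real.log l - Real.log y))) =
          ∫ y in δ..l, ((B + 2 * (B * Real.log l)) - (2 * B) * Real.log y) := by
        congr 1; ext y; ring
      rw [e, intervalIntegral.integral_sub (by simp) (intervalIntegral.intervalIntegrable_log'.const_mul _),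
        intervalIntegral.integral_const_mul, integral_log, intervalIntegral.integral_const]
      have : Real.log δ ≤ Real.log l := Real.log_le_log hδ hl
      have h5 : 0 ≤ B * δ * (Real.log l - Real.log δ) := by
        apply mul_nonneg (by positivity); linarith
      have h6 : 0 ≤ B * δ := by positivity
      simp only [smul_eq_mul]
      nlinarith
  have h2 : ‖(∫ x' : ℝ in x₀..(x₀ + l), g (x' + l * I)) - l * g (x + l * I)‖ ≤ B * l := by
    have : (l : ℂ) * g (x + l * I) = ∫ x' : ℝ in x₀..(x₀ + l), g (x + l * I) := by
      rw [intervalIntegral.integral_const]; simp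
    rw [this, ← intervalIntegral.integral_sub (hcl.intervalIntegrable _ _) (by simp)]
    refine (intervalIntegral.norm_integral_le_of_norm_le_const (C := B) fun y hy => ?_).trans ?_
    · rw [Set.uIoc_of_le (by linarith)] at hy
      have a3 := hg.horiz (w₁ := x + l * I) (w₂ := y + l * I) hl0 (by simp) (by simp)
      refine a3.trans ?_
      have : ((y + l * I) - (x + l * I) : ℂ) = ((y - x : ℝ) : ℂ) := by push_cast; ring
      rw [this, norm_real, Real.norm_eq_abs, div_mul_eq_mul_div, div_le_iff₀ hl0]
      gcongr
      rw [abs_le]; constructor <;> linarith [hx.1, hx.2, hy.1, hy.2]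
    · simp [abs_of_pos hl0]
  have hlc : (l : ℂ) ≠ 0 := by exact_mod_cast hl0.ne'
  have e : hAvg g δ x₀ l - g (x + l * I) =
     (((∫ x' : ℝ in x₀..(x₀ + l), g (x' + l * I)) - l * g (x + l * I)) -
       I * ((∫ y : ℝ in δ..l, g ((x₀ + l : ℝ) + y * I)) - ∫ y : ℝ in δ..l, g (x₀ + y * I))) / l := by
    unfold hAvg
    rw [eq_div_iff hlc, sub_mul, div_mul_cancel₀ _ hlc]
    simp only [smul_eq_mul] at hrect
    linear_combination hrect
  rw [e, norm_div, norm_real, Real.norm_eq_abs, abs_of_pos hl0, div_le_iff₀ hl0]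
  refine (norm_sub_le _ _).trans ?_
  rw [norm_mul, norm_I, one_mul]
  linarith

lemma exp_avg_le {a b t D : ℝ} (h : |a - b| ≤ 2 * D) :
    (Real.exp (t * a) + Real.exp (t * b)) / 2 ≤
      Real.exp (t * ((a + b) / 2) + t ^ 2 * D ^ 2 / 2) := by
  have e : (Real.exp (t * a) + Real.exp (t * b)) / 2 =
      Real.exp (t * ((a + b) / 2)) * Real.cosh (t * ((a - b) / 2)) := by
    rw [Real.cosh_eq, mul_div_assoc', mul_add, ← Real.exp_add, ← Real.exp_add]
    congr 3 <;> ring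
  rw [e, Real.exp_add]
  gcongr
  refine (Real.cosh_le_exp_half_sq _).trans (Real.exp_le_exp.2 ?_)
  have : (a - b) ^ 2 ≤ (2 * D) ^ 2 := sq_le_sq' (by linarith [(abs_le.1 h).1]) (abs_le.1 h).2
  nlinarith [mul_le_mul_of_nonneg_left this (sq_nonneg t)]

lemma HPBloch.tail_ind {g : ℂ → ℂ} {B : ℝ} (hg : HPBloch g B) {δ : ℝ} (hδ : 0 < δ) {t : ℝ}
    (ht : 0 ≤ t) (μ : ℝ) (N : ℕ) : ∀ x₀ : ℝ,
    volume {x : ℝ | x ∈ Set.Ico x₀ (x₀ + 2 ^ N * δ) ∧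
        ∃ k ≤ N, μ + 4 * B ≤ (g (x + (2 ^ k * δ : ℝ) * I)).re} ≤
      ENNReal.ofReal (2 ^ N * δ *
        Real.exp (t * ((hAvg g δ x₀ (2 ^ N * δ)).re - μ) + N * (t ^ 2 * (9 * B) ^ 2 / 2))) := by
  have hB := hg.1
  -- the trivial case
  have triv : ∀ (N : ℕ) (x₀ : ℝ), μ ≤ (hAvg g δ x₀ (2 ^ N * δ)).re → 
      volume {x : ℝ | x ∈ Set.Ico x₀ (x₀ + 2 ^ N * δ) ∧
        ∃ k ≤ N, μ + 4 * B ≤ (g (x + (2 ^ k * δ : ℝ) * I)).re} ≤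
      ENNReal.ofReal (2 ^ N * δ *
        Real.exp (t * ((hAvg g δ x₀ (2 ^ N * δ)).re - μ) + N * (t ^ 2 * (9 * B) ^ 2 / 2))) := by
    intro N x₀ h
    refine (measure_mono (t := Set.Ico x₀ (x₀ + 2 ^ N * δ)) fun x hx => hx.1).trans ?_
    rw [Real.volume_Ico]
    apply ENNReal.ofReal_le_ofReal
    have h0 : 0 ≤ t * ((hAvg g δ x₀ (2 ^ N * δ)).re - μ) + N * (t ^ 2 * (9 * B) ^ 2 / 2) := by
      have := mul_nonneg ht (sub_nonneg.2 h)
      positivity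
    have h1 := Real.one_le_exp h0
    have h2 : 0 ≤ 2 ^ N * δ := by positivity
    nlinarith
  have hle : ∀ N : ℕ, δ ≤ 2 ^ N * δ := fun N => by
    have : (1 : ℝ) ≤ 2 ^ N := one_le_pow₀ (by norm_num)
    nlinarith
  have top : ∀ (N : ℕ) (x₀ x : ℝ), (hAvg g δ x₀ (2 ^ N * δ)).re < μ →
      x ∈ Set.Ico x₀ (x₀ + 2 ^ N * δ) → (g (x + (2 ^ N * δ : ℝ) * I)).re < μ + 4 * B := by
    intro N x₀ x h hx
    have h1 := hg.avg_close hδ (hle N) (Set.Ico_subset_Icc_self hx)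
    have h2 := (abs_le.1 ((abs_re_le_norm _).trans h1)).1
    rw [sub_re] at h2
    linarith
  induction N with
  | zero =>
    intro x₀
    rcases le_or_gt μ (hAvg g δ x₀ (2 ^ 0 * δ)).re with h | h
    · exact triv 0 x₀ h
    · have : {x : ℝ | x ∈ Set.Ico x₀ (x₀ + 2 ^ 0 * δ) ∧
        ∃ k ≤ 0, μ + 4 * B ≤ (g (x + (2 ^ k * δ : ℝ) * I)).re} = ∅ := by
        ext x
        simp only [Set.mem_ofPred_eq, Set.mem_empty_iff_false, iff_false]
        rintro ⟨hx, k, hk, hk2⟩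
        obtain rfl : k = 0 := by omega
        exact absurd (top 0 x₀ x h hx) (not_lt.2 hk2)
      rw [this]; simp
  | succ N ih =>
    intro x₀
    rcases le_or_gt μ (hAvg g δ x₀ (2 ^ (N + 1) * δ)).re with h | h
    · exact triv (N + 1) x₀ h
    set l : ℝ := 2 ^ N * δ with hl
    have hl0 : 0 < l := by positivity
    have hl2 : (2 : ℝ) ^ (N + 1) * δ = 2 * l := by rw [hl]; ring
    have hsub : {x : ℝ | x ∈ Set.Ico x₀ (x₀ + 2 ^ (N + 1) * δ) ∧
        ∃ k ≤ N + 1, μ + 4 * B ≤ (g (x + (2 ^ k * δ : ℝ) * I)).re} ⊆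
        {x : ℝ | x ∈ Set.Ico x₀ (x₀ + l) ∧
          ∃ k ≤ N, μ + 4 * B ≤ (g (x + (2 ^ k * δ : ℝ) * I)).re} ∪
        {x : ℝ | x ∈ Set.Ico (x₀ + l) (x₀ + l + l) ∧
          ∃ k ≤ N, μ + 4 * B ≤ (g (x + (2 ^ k * δ : ℝ) * I)).re} := by
      rintro x ⟨hx, k, hk, hk2⟩
      have hkN : k ≤ N := by
        rcases Nat.lt_or_ge k (N + 1) with h' | h'
        · omega
        · obtain rfl : k = N + 1 := by omega
          exact absurd (top _ x₀ x h hx) (not_lt.2 hk2)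
      rw [hl2] at hx
      rcases lt_or_ge x (x₀ + l) with h' | h'
      · exact Or.inl ⟨⟨hx.1, h'⟩, k, hkN, hk2⟩
      · exact Or.inr ⟨⟨h', by linarith [hx.2]⟩, k, hkN, hk2⟩
    refine (measure_mono hsub).trans ((measure_union_le _ _).trans ?_)
    refine (add_le_add (ih x₀) (ih (x₀ + l))).trans ?_
    rw [← ENNReal.ofReal_add (by positivity) (by positivity)]
    apply ENNReal.ofReal_le_ofReal
    rw [hl2, hg.avg_half hδ x₀ hl0]
    have c1 := hg.avg_close hδ (hle N) (x₀ := x₀) (x := x₀ + l) (by rw [← hl]; constructor <;> linarith)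
    have c2 := hg.avg_close hδ (hle N) (x₀ := x₀ + l) (x := x₀ + l) (by rw [← hl]; constructor <;> linarith)
    rw [← hl] at c1 c2
    have c3 : ‖hAvg g δ x₀ l - hAvg g δ (x₀ + l) l‖ ≤ 8 * B := by
      have : hAvg g δ x₀ l - hAvg g δ (x₀ + l) l = (hAvg g δ x₀ l - g ((x₀ + l : ℝ) + l * I))
        - (hAvg g δ (x₀ + l) l - g ((x₀ + l : ℝ) + l * I)) := by ring
      rw [this]
      exact (norm_sub_le _ _).trans (by linarith)
    have c4 := (abs_re_le_norm _).trans c3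
    rw [sub_re] at c4
    have c5 := exp_avg_le (t := t) (D := 9 * B) (c4.trans (by linarith))
    set a := (hAvg g δ x₀ l).re
    set b := (hAvg g δ (x₀ + l) l).re
    have e1 : ((hAvg g δ x₀ l + hAvg g δ (x₀ + l) l) / 2).re = (a + b) / 2 := by
      simp [a, b]
    rw [e1]
    set K := (N : ℝ) * (t ^ 2 * (9 * B) ^ 2 / 2)
    have e2 : ∀ s : ℝ, Real.exp (t * (s - μ) + K) = Real.exp (t * s) * Real.exp (K - t * μ) := by
      intro s; rw [← Real.exp_add]; congr 1; ring
    have e3 : Real.exp (t * ((a + b) / 2 - μ) + ((N + 1 : ℕ) : ℝ) * (t ^ 2 * (9 * B) ^ 2 / 2)) =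
        Real.exp (t * ((a + b) / 2) + t ^ 2 * (9 * B) ^ 2 / 2) * Real.exp (K - t * μ) := by
      rw [← Real.exp_add]; congr 1; simp only [K]; push_cast; ring
    rw [e2, e2, e3]
    have hE := Real.exp_pos (K - t * μ)
    calc _ = 2 * l * (((Real.exp (t * a) + Real.exp (t * b)) / 2) * Real.exp (K - t * μ)) := by ring
      _ ≤ _ := by gcongr

lemma HPBloch.tail {g : ℂ → ℂ} {B : ℝ} (hg : HPBloch g B) (hB : 0 < B) (q : ℝ) {N : ℕ} (hN : 0 < N)
    {μ : ℝ} (hμ : 0 ≤ μ) :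
    volume {x : ℝ | x ∈ Set.Ico q (q + 1) ∧
        ∃ m ≤ N, μ + ((g (q + I)).re + 8 * B) ≤ (g (x + ((1 / 2) ^ m : ℝ) * I)).re} ≤
      ENNReal.ofReal (Real.exp (-(μ ^ 2 / (2 * N * (9 * B) ^ 2)))) := by
  have hδ : (0 : ℝ) < (1 / 2) ^ N := by positivity
  have hone : (2 : ℝ) ^ N * (1 / 2) ^ N = 1 := by rw [← mul_pow]; norm_num
  have hNr : (0 : ℝ) < N := by exact_mod_cast hN
  have h := hg.tail_ind hδ (t := μ / (N * (9 * B) ^ 2)) (by positivity)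
    (μ + ((g (q + I)).re + 4 * B)) N q
  rw [hone] at h
  have hA := hg.avg_close hδ (l := 1) (x₀ := q) (x := q) (pow_le_one₀ (by norm_num) (by norm_num))
    (by constructor <;> linarith)
  have hA2 := (abs_le.1 ((abs_re_le_norm _).trans hA)).2
  rw [sub_re] at hA2
  simp only [ofReal_one, one_mul] at hA2
  refine (measure_mono ?_).trans (h.trans (ENNReal.ofReal_le_ofReal ?_))
  · rintro x ⟨hx, m, hm, h2⟩
    refine ⟨hx, N - m, by omega, ?_⟩
    have : (2 : ℝ) ^ (N - m) * (1 / 2) ^ N = (1 / 2) ^ m := by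
      obtain ⟨d, rfl⟩ := Nat.exists_eq_add_of_le hm
      rw [Nat.add_sub_cancel_left, pow_add, mul_left_comm, ← mul_pow]; norm_num
    rw [this]
    linarith
  · rw [one_mul]
    apply Real.exp_le_exp.2
    set A := (hAvg g ((1 / 2) ^ N) q 1).re
    have h1 : A - (μ + ((g (q + I)).re + 4 * B)) ≤ -μ := by linarith
    have h2 := mul_le_mul_of_nonneg_left h1 (show 0 ≤ μ / (N * (9 * B) ^ 2) by positivity)
    refine (add_le_add_left h2 _).trans (le_of_eq ?_)
    field_simp
    ring

lemma HPBloch.borel_cantelli {g : ℂ → ℂ} {B : ℝ} (hg : HPBloch g B) (hB : 0 < B) (q : ℝ) :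
    ∀ᵐ x : ℝ, x ∈ Set.Ico q (q + 1) → ∀ᶠ j : ℕ in atTop, ∀ m ≤ 2 ^ j,
      (g (x + ((1 / 2) ^ m : ℝ) * I)).re <
        18 * B * √(2 ^ j * Real.log (j + 1)) + ((g (q + I)).re + 8 * B) := by
  have hs : (∑' j : ℕ, volume {x : ℝ | x ∈ Set.Ico q (q + 1) ∧
        ∃ m ≤ 2 ^ j, 18 * B * √(2 ^ j * Real.log (j + 1)) + ((g (q + I)).re + 8 * B) ≤
          (g (x + ((1 / 2) ^ m : ℝ) * I)).re}) ≠ ⊤ := by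
    have hsum : Summable (fun j : ℕ => 1 / ((j + 1 : ℕ) : ℝ) ^ 2) :=
      (summable_nat_add_iff 1).2 (Real.summable_one_div_nat_pow.2 (by norm_num))
    refine ne_top_of_le_ne_top hsum.tsum_ofReal_ne_top (ENNReal.tsum_le_tsum fun j => ?_)
    refine (hg.tail hB q (N := 2 ^ j) (by positivity) (by positivity)).trans
      (ENNReal.ofReal_le_ofReal (le_of_eq ?_))
    have hj : (0 : ℝ) < j + 1 := by positivity
    have hlog : 0 ≤ Real.log ((j : ℝ) + 1) := Real.log_nonneg (by linarith [Nat.cast_nonneg (α := ℝ) j])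
    rw [mul_pow, Real.sq_sqrt (by positivity)]
    have : (18 * B) ^ 2 * (2 ^ j * Real.log (j + 1)) / (2 * ((2 ^ j : ℕ) : ℝ) * (9 * B) ^ 2) =
        2 * Real.log (j + 1) := by
      push_cast; field_simp; ring
    rw [this, Real.exp_neg, ← Nat.cast_two, ← Real.log_pow, Real.exp_log (by positivity)]
    push_cast; simp
  filter_upwards [ae_eventually_notMem hs] with x hx hxq
  filter_upwards [hx] with j hj m hm
  by_contra hcon
  exact hj ⟨hxq, m, hm, not_lt.1 hcon⟩

lemma HPBloch.final_ae {g : ℂ → ℂ} {B : ℝ} (hg : HPBloch g B) (hB : 0 < B) (q : ℝ) :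
    ∀ᵐ x : ℝ, x ∈ Set.Ico q (q + 1) → ∀ᶠ L : ℝ in atTop, ∀ y : ℝ, 0 < y → y ≤ 1 →
      -Real.log y ≤ L → (g (x + y * I)).re ≤ (54 * B + 1) * √(L * Real.log (Real.log L)) := by
  filter_upwards [hg.borel_cantelli hB q] with x hx hxq
  obtain ⟨j₀, hj₀⟩ := eventually_atTop.1 (hx hxq)
  set M := (g (q + I)).re + 8 * B
  have t1 : Tendsto (fun L : ℝ => L * Real.log (Real.log L)) atTop atTop :=
    tendsto_id.atTop_mul_atTop₀ (Real.tendsto_log_atTop.comp Real.tendsto_log_atTop)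
  have t2 : Tendsto (fun L : ℝ => √(L * Real.log (Real.log L))) atTop atTop :=
    Real.tendsto_sqrt_atTop.comp t1
  have t3 : ∀ᶠ L : ℝ in atTop, (5 : ℝ) ≤ Real.log L := Real.tendsto_log_atTop.eventually_ge_atTop 5
  filter_upwards [t2.eventually_ge_atTop (M + B), t3, eventually_ge_atTop ((2 : ℝ) ^ j₀),
    eventually_ge_atTop (1 : ℝ)] with L hL1 hL2 hL3 hL4 y hy hy1 hyL
  have hlog2 : (1 / 2 : ℝ) ≤ Real.log 2 := by linarith [Real.log_two_gt_d9]
  obtain ⟨m, hm1, hm2⟩ := exists_nat_pow_near_of_lt_one hy hy1 (y := (1 / 2 : ℝ)) (by norm_num) (by norm_num)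
  obtain ⟨n, hn1, hn2⟩ := exists_nat_pow_near (x := 2 * L) (y := (2 : ℝ)) (by linarith) (by norm_num)
  -- m ≤ 2 L
  have hm : (m : ℝ) ≤ 2 * L := by
    have := Real.log_le_log hy hm2
    rw [Real.log_pow, one_div, Real.log_inv] at this
    have h0 : (0 : ℝ) ≤ m := Nat.cast_nonneg m
    nlinarith
  have hm' : m ≤ 2 ^ (n + 1) := by
    have : (m : ℝ) < 2 ^ (n + 1) := hm.trans_lt hn2
    exact_mod_cast this.le
  have hjn : j₀ ≤ n + 1 := by
    have : (2 : ℝ) ^ j₀ < 2 ^ (n + 1) := by linarith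
    exact ((pow_lt_pow_iff_right₀ (by norm_num : (1 : ℝ) < 2)).1 this).le
  have key := hj₀ (n + 1) hjn m hm'
  have hv := hg.horiz (w₁ := x + ((1 / 2) ^ m : ℝ) * I) (w₂ := x + y * I) hy (by rw [add_im, ofReal_im, im_ofReal_mul, I_im]; simpa using hm2) (by simp)
  have hv1 : ‖(x + y * I - (x + ((1 / 2) ^ m : ℝ) * I) : ℂ)‖ ≤ y := by
    have : (x + y * I - (x + ((1 / 2) ^ m : ℝ) * I) : ℂ) = ((y - (1 / 2) ^ m : ℝ) : ℂ) * I := by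
      push_cast; ring
    rw [this, norm_mul, norm_I, mul_one, norm_real, Real.norm_eq_abs, abs_le]
    rw [pow_succ] at hm1
    constructor <;> linarith
  have hv2 : ‖g (x + y * I) - g (x + ((1 / 2) ^ m : ℝ) * I)‖ ≤ B := by
    refine hv.trans ?_
    calc B / y * _ ≤ B / y * y := by gcongr
      _ = B := by field_simp
  have hv3 := (abs_le.1 ((abs_re_le_norm _).trans hv2)).2
  rw [sub_re] at hv3
  -- size of log(j+1)
  have hn3 : (n : ℝ) ≤ 2 * Real.log (2 * L) := by
    have := Real.log_le_log (by positivity) hn1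
    rw [Real.log_pow] at this
    have h0 : (0 : ℝ) ≤ n := Nat.cast_nonneg n
    nlinarith
  have hlog2' : Real.log 2 ≤ 1 := by linarith [Real.log_two_lt_d9]
  have hn4 : ((n + 1 : ℕ) : ℝ) + 1 ≤ Real.log L ^ 2 := by
    rw [Real.log_mul (by norm_num) (by linarith)] at hn3
    push_cast
    nlinarith
  have hn5 : Real.log (((n + 1 : ℕ) : ℝ) + 1) ≤ 2 * Real.log (Real.log L) := by
    have := Real.log_le_log (by positivity) hn4
    rwa [Real.log_pow] at this
  have hll : 0 ≤ Real.log (Real.log L) := Real.log_nonneg (by linarith)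
  have hs : √(2 ^ (n + 1) * Real.log (((n + 1 : ℕ) : ℝ) + 1)) ≤ 3 * √(L * Real.log (Real.log L)) := by
    rw [show (3 : ℝ) = √9 by rw [show (9 : ℝ) = 3 ^ 2 by norm_num]; simp, ← Real.sqrt_mul (by norm_num)]
    apply Real.sqrt_le_sqrt
    calc 2 ^ (n + 1) * Real.log (((n + 1 : ℕ) : ℝ) + 1) ≤ (4 * L) * (2 * Real.log (Real.log L)) := by
          apply mul_le_mul _ hn5 _ (by linarith)
          · rw [pow_succ]; linarith
          · exact Real.log_nonneg (by push_cast; linarith [Nat.cast_nonneg (α := ℝ) n])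
      _ ≤ 9 * (L * Real.log (Real.log L)) := by
          have : 0 ≤ L * Real.log (Real.log L) := by positivity
          linarith
  have := mul_le_mul_of_nonneg_left hs (show 0 ≤ 18 * B by positivity)
  nlinarith

lemma univ_deriv_ne_zero {f : ℂ → ℂ} (hf : DifferentiableOn ℂ f (ball 0 1))
    (hi : Set.InjOn f (ball 0 1)) {a : ℂ} (ha : a ∈ ball (0 : ℂ) 1) : deriv f a ≠ 0 := by
  set U := ball (0 : ℂ) 1 with hU
  have hUo : IsOpen U := isOpen_ball
  have hUc : IsPreconnected U := (convex_ball (0 : ℂ) 1).isPreconnected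
  have han : AnalyticOnNhd ℂ f U := hf.analyticOnNhd hUo
  have hnc : ¬ ∃ w, ∀ z ∈ U, f z = w := by
    rintro ⟨w, hw⟩
    have h0 : (0 : ℂ) ∈ U := by simp [hU]
    have h1 : (1 / 2 : ℂ) ∈ U := by simp [hU]; norm_num
    have := hi h0 h1 ((hw _ h0).trans (hw _ h1).symm)
    norm_num at this
  have hopen : ∀ s ⊆ U, IsOpen s → IsOpen (f '' s) :=
    (han.is_constant_or_isOpen hUc).resolve_left hnc
  intro hda
  set g := Function.invFunOn f U with hgdef
  have hgf : ∀ z ∈ U, g (f z) = z := fun z hz => hi.leftInvOn_invFunOn hz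
  have hgc : ∀ z ∈ U, ContinuousAt g (f z) := by
    intro z hz
    rw [ContinuousAt, hgf z hz]
    intro V hV
    obtain ⟨V', hV'1, hV'2, hV'3⟩ := _root_.mem_nhds_iff.1 (inter_mem hV (hUo.mem_nhds hz))
    refine mem_map.2 (mem_of_superset ((hopen V' (fun x hx => (hV'1 hx).2) hV'2).mem_nhds ⟨z, hV'3, rfl⟩) ?_)
    rintro _ ⟨x, hx, rfl⟩
    have := hV'1 hx
    rw [Set.mem_preimage, hgf x this.2]
    exact this.1
  have hdan : AnalyticOnNhd ℂ (deriv f) U := han.deriv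
  rcases (hdan a ha).eventually_eq_zero_or_eventually_ne_zero with h | h
  · have h0 := hdan.eqOn_zero_of_preconnected_of_eventuallyEq_zero hUc ha h
    obtain ⟨w, hw⟩ := hUo.exists_is_const_of_deriv_eq_zero hUc hf h0
    exact hnc ⟨w, hw⟩
  · have h' := eventually_nhdsWithin_iff.1 h
    obtain ⟨ε, hε, hεs⟩ := Metric.eventually_nhds_iff_ball.1 (h'.and (hUo.mem_nhds ha))
    have hbU : ball a ε ⊆ U := fun z hz => (hεs z hz).2
    have hWo := hopen (ball a ε) hbU isOpen_ball
    have hWn : f '' ball a ε ∈ nhds (f a) := hWo.mem_nhds ⟨a, mem_ball_self hε, rfl⟩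
    have hd : DifferentiableOn ℂ g (f '' ball a ε) := by
      rw [← differentiableOn_compl_singleton_and_continuousAt_iff hWn]
      refine ⟨?_, hgc a ha⟩
      rintro _ ⟨⟨z, hz, rfl⟩, hne⟩
      have hza : z ≠ a := by rintro rfl; exact hne rfl
      have hdz := (hεs z hz).1 hza
      have hev : ∀ᶠ y in nhds (f z), f (g y) = y := by
        filter_upwards [hWo.mem_nhds ⟨z, hz, rfl⟩]
        rintro _ ⟨x, hx, rfl⟩
        rw [hgf x (hbU hx)]
      have := HasDerivAt.of_local_left_inverse (hgc z (hbU hz))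
        (by rw [hgf z (hbU hz)]; exact (hf.differentiableAt (hUo.mem_nhds (hbU hz))).hasDerivAt) hdz hev
      exact this.differentiableAt.differentiableWithinAt
    have h1 := (hd.differentiableAt hWn).hasDerivAt
    have h2 := (hf.differentiableAt (hUo.mem_nhds ha)).hasDerivAt
    have h3 := h1.comp a h2
    have h4 : HasDerivAt (g ∘ f) 1 a := by
      refine (hasDerivAt_id a).congr_of_eventuallyEq ?_
      filter_upwards [hUo.mem_nhds ha] with z hz using hgf z hz
    have := h3.unique h4
    rw [hda, mul_zero] at this
    exact zero_ne_one this

lemma polar_lower {φ : ℂ → ℝ} {ψ : ℝ → ℝ} {ρ r : ℝ} (hρ : 0 < ρ) (hr : ρ ≤ r)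
    (hφ : ContinuousOn φ (closedBall 0 r \ ball 0 ρ)) (hψ : ContinuousOn ψ (Set.Icc ρ r))
    (h : ∀ s ∈ Set.Icc ρ r, ψ s ≤ Real.circleAverage φ 0 s) :
    2 * Real.pi * ∫ s in ρ..r, s * ψ s ≤ ∫ z in closedBall (0 : ℂ) r \ ball 0 ρ, φ z := by
  set A := closedBall (0 : ℂ) r \ ball 0 ρ with hA
  have hAm : MeasurableSet A := measurableSet_closedBall.diff measurableSet_ball
  set P : ℝ × ℝ → ℂ := fun p => (p.1 : ℂ) * (Real.cos p.2 + Real.sin p.2 * I) with hP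
  have hPA : ∀ p : ℝ × ℝ, 0 < p.1 → (P p ∈ A ↔ p.1 ∈ Set.Icc ρ r) := by
    intro p hp
    have : ‖P p‖ = p.1 := by
      have := norm_polarCoord_symm p
      rw [Complex.polarCoord_symm_apply] at this
      rw [hP, this, abs_of_pos hp]
    simp only [hA, Set.mem_sdiff, mem_closedBall_zero_iff, mem_ball_zero_iff, this, not_lt, Set.mem_Icc]
    tauto
  have hPc : ContinuousOn (fun p : ℝ × ℝ => p.1 * φ (P p)) (Set.Icc ρ r ×ˢ Set.univ) := by
    apply continuousOn_fst.mul
    refine hφ.comp (by fun_prop) ?_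
    intro p hp
    exact (hPA p (hρ.trans_le hp.1.1)).2 hp.1
  have h_integ : IntegrableOn (fun p : ℝ × ℝ => p.1 * φ (P p)) (Set.Icc ρ r ×ˢ Set.Ioo (-Real.pi) Real.pi)
      (volume.prod volume) := by
    refine IntegrableOn.mono_set (t := Set.Icc ρ r ×ˢ Set.Icc (-Real.pi) Real.pi) ?_
      (Set.prod_mono le_rfl Set.Ioo_subset_Icc_self)
    exact (hPc.mono (Set.prod_mono le_rfl (Set.subset_univ _))).integrableOn_compact
      (isCompact_Icc.prod isCompact_Icc)
  have e1 : ∫ z in A, φ z = ∫ s in Set.Icc ρ r, ∫ θ in Set.Ioo (-Real.pi) Real.pi, s * φ (P (s, θ)) := by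
    rw [← setIntegral_prod _ h_integ, ← integral_indicator hAm, ← Complex.integral_comp_polarCoord_symm]
    rw [← integral_indicator (polarCoord.open_target.measurableSet),
      ← integral_indicator (measurableSet_Icc.prod measurableSet_Ioo)]
    congr 1
    ext p
    simp only [Complex.polarCoord_symm_apply]
    by_cases hp : p ∈ Set.Icc ρ r ×ˢ Set.Ioo (-Real.pi) Real.pi
    · have hp1 : 0 < p.1 := hρ.trans_le hp.1.1
      have hpt : p ∈ polarCoord.target := ⟨hp1, hp.2⟩
      rw [Set.indicator_of_mem hp, Set.indicator_of_mem hpt,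
        Set.indicator_of_mem ((hPA p hp1).2 hp.1)]
      rfl
    · rw [Set.indicator_of_notMem hp]
      by_cases hpt : p ∈ polarCoord.target
      · rw [Set.indicator_of_mem hpt, Set.indicator_of_notMem, smul_zero]
        intro hcon
        exact hp ⟨(hPA p hpt.1).1 hcon, hpt.2⟩
      · rw [Set.indicator_of_notMem hpt]
  have e2 : ∀ s : ℝ, ∫ θ in Set.Ioo (-Real.pi) Real.pi, s * φ (P (s, θ)) =
      2 * Real.pi * (s * Real.circleAverage φ 0 s) := by
    intro s
    rw [Real.circleAverage_def, ← integral_Ioc_eq_integral_Ioo,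
      ← intervalIntegral.integral_of_le (by linarith [Real.pi_pos]),
      intervalIntegral.integral_const_mul]
    have hper : Function.Periodic (fun θ => φ (circleMap 0 s θ)) (2 * Real.pi) := by
      intro θ; simp only [periodic_circleMap 0 s θ]
    have h1 := hper.intervalIntegral_add_eq (-Real.pi) 0
    rw [zero_add, show -Real.pi + 2 * Real.pi = Real.pi by ring] at h1
    have h2 : ∀ θ : ℝ, P (s, θ) = circleMap 0 s θ := by
      intro θ; simp [hP, circleMap, Complex.exp_mul_I]
    simp only [h2]
    rw [h1, smul_eq_mul]
    have := Real.pi_pos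
    field_simp
  rw [e1, intervalIntegral.integral_of_le hr, ← integral_Icc_eq_integral_Ioc, ← integral_const_mul]
  apply setIntegral_mono_on
  · exact ((continuousOn_const.mul (continuousOn_id.mul hψ)).integrableOn_compact isCompact_Icc)
  · have := h_integ
    rw [IntegrableOn, ← Measure.prod_restrict] at this
    exact this.integral_prod_left
  · exact measurableSet_Icc
  · intro s hs
    rw [e2]
    have := h s hs
    have h0 : 0 < s := hρ.trans_le hs.1
    have := Real.pi_pos
    gcongr

lemma circle_lower {q : ℂ → ℂ} (hq : DifferentiableOn ℂ q (ball 0 1)) {s : ℝ} (hs0 : 0 < s)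
    (hs1 : s < 1) :
    1 / s ^ 4 + ‖q 0‖ ^ 2 ≤
      Real.circleAverage (fun z => ‖-(z ^ 2)⁻¹ + q z‖ ^ 2) 0 s := by
  set c := q 0 with hc
  set H : ℂ → ℂ := fun z => ((1 / s ^ 4 + ‖c‖ ^ 2 : ℝ) : ℂ) +
    (-2 / (s : ℂ) ^ 4 * (z ^ 2 * q z) + 2 * (starRingEnd ℂ c) * (q z - c)) with hH
  have hHd : DifferentiableOn ℂ H (ball 0 1) := by
    have : DifferentiableOn ℂ (fun z : ℂ => z ^ 2) (ball 0 1) := by fun_prop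
    exact ((this.mul hq).const_mul _ |>.add ((hq.sub_const c).const_mul _)).const_add _
  have hsub : closedBall (0 : ℂ) |s| ⊆ ball 0 1 := by
    rw [abs_of_pos hs0]; exact closedBall_subset_ball hs1
  have hdc : DiffContOnCl ℂ H (ball 0 |s|) :=
    (hHd.mono hsub).diffContOnCl_ball subset_rfl
  have hav := hdc.circleAverage
  have hsph : sphere (0 : ℂ) |s| ⊆ ball 0 1 := sphere_subset_closedBall.trans hsub
  have hci : CircleIntegrable H 0 s :=
    (hHd.continuousOn.mono hsph).circleIntegrable'
  have h1 := reCLM.circleAverage_comp_comm hci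
  rw [hav] at h1
  have h2 : reCLM (H 0) = 1 / s ^ 4 + ‖c‖ ^ 2 := by
    simp only [hH, ← hc]
    simp [← ofReal_pow]
  rw [← h2, ← h1]
  have hci1 : CircleIntegrable (reCLM ∘ H) 0 s :=
    (reCLM.continuous.comp_continuousOn (hHd.continuousOn.mono hsph)).circleIntegrable'
  have hci2 : CircleIntegrable (fun z => ‖-(z ^ 2)⁻¹ + q z‖ ^ 2) 0 s := by
    apply ContinuousOn.circleIntegrable'
    refine ((ContinuousOn.add ?_ (hq.continuousOn.mono hsph)).norm).pow 2
    refine (ContinuousOn.inv₀ (by fun_prop) ?_).neg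
    intro z hz
    have : ‖z‖ = s := by simpa [abs_of_pos hs0] using hz
    have : z ≠ 0 := by rintro rfl; simp at this; linarith
    positivity
  refine Real.circleAverage_mono hci1 hci2 ?_
  intro z hz
  have hzs : ‖z‖ = s := by simpa [abs_of_pos hs0] using hz
  have hz0 : z ≠ 0 := by rintro rfl; simp at hzs; linarith
  -- pointwise
  have ha : ‖-(z ^ 2)⁻¹‖ ^ 2 = 1 / s ^ 4 := by
    rw [norm_neg, norm_inv, norm_pow, hzs]; field_simp
  have hconj : starRingEnd ℂ (-(z ^ 2)⁻¹) = - z ^ 2 / (s : ℂ) ^ 4 := by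
    have : (starRingEnd ℂ z) * z = (s : ℂ) ^ 2 := by
      rw [mul_comm, mul_conj, normSq_eq_norm_sq, hzs]; push_cast; ring
    have hcz : starRingEnd ℂ z ≠ 0 := by simpa using hz0
    have hsc : (s : ℂ) ≠ 0 := by exact_mod_cast hs0.ne'
    rw [map_neg, map_inv₀, map_pow, neg_div, neg_inj, inv_eq_one_div, div_eq_div_iff (by positivity) (by positivity)]
    linear_combination (-(s:ℂ)^2 - (starRingEnd ℂ z) * z) * this
  have e1 : ‖-(z ^ 2)⁻¹ + q z‖ ^ 2 = 1 / s ^ 4 + ‖q z‖ ^ 2 + 2 * (- z ^ 2 / (s : ℂ) ^ 4 * q z).re := by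
    rw [← hconj, ← ha, ← normSq_eq_norm_sq, ← normSq_eq_norm_sq, ← normSq_eq_norm_sq, normSq_add]
    have : (-(z ^ 2)⁻¹ * starRingEnd ℂ (q z)).re = (starRingEnd ℂ (-(z ^ 2)⁻¹) * q z).re := by
      rw [← conj_re]; simp
    rw [this]
  have e2 : ‖c‖ ^ 2 + 2 * (starRingEnd ℂ c * (q z - c)).re ≤ ‖q z‖ ^ 2 := by
    have h3 : ‖q z‖ ^ 2 = ‖c‖ ^ 2 + ‖q z - c‖ ^ 2 + 2 * (starRingEnd ℂ c * (q z - c)).re := by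
      rw [← normSq_eq_norm_sq, ← normSq_eq_norm_sq, ← normSq_eq_norm_sq]
      have := normSq_add c (q z - c)
      rw [add_sub_cancel] at this
      rw [this]
      have : (c * starRingEnd ℂ (q z - c)).re = (starRingEnd ℂ c * (q z - c)).re := by
        rw [← conj_re]; simp
      rw [this]
    nlinarith [sq_nonneg ‖q z - c‖]
  show (H z).re ≤ _
  rw [e1]
  have e3 : (H z).re = 1 / s ^ 4 + ‖c‖ ^ 2 + 2 * (- z ^ 2 / (s : ℂ) ^ 4 * q z).re +
      2 * (starRingEnd ℂ c * (q z - c)).re := by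
    have : H z = ((1 / s ^ 4 + ‖c‖ ^ 2 : ℝ) : ℂ) + ((2 : ℝ) : ℂ) * (- z ^ 2 / (s : ℂ) ^ 4 * q z) +
      ((2 : ℝ) : ℂ) * (starRingEnd ℂ c * (q z - c)) := by
      simp only [hH]; push_cast; ring
    rw [this, add_re, add_re, re_ofReal_mul, re_ofReal_mul, ofReal_re]
  rw [e3]
  linarith

lemma det_mul_right (a : ℂ) :
    ((ContinuousLinearMap.toSpanSingleton ℂ a).restrictScalars ℝ : ℂ →L[ℝ] ℂ).det = ‖a‖ ^ 2 := by
  have : ((ContinuousLinearMap.toSpanSingleton ℂ a).restrictScalars ℝ : ℂ →L[ℝ] ℂ).det =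
     LinearMap.det ((ContinuousLinearMap.toSpanSingleton ℂ a : ℂ →ₗ[ℂ] ℂ).restrictScalars ℝ) := rfl
  rw [this, LinearMap.det_restrictScalars, Algebra.norm_complex_apply, normSq_eq_norm_sq]
  simp

lemma area_bound {F p : ℂ → ℂ} (hF : DifferentiableOn ℂ F (ball 0 1)) (hFi : Set.InjOn F (ball 0 1))
    (hF0 : F 0 = 0) (hp : DifferentiableOn ℂ p (ball 0 1)) (hp0 : p 0 = 0)
    (hFp : ∀ z ∈ ball (0 : ℂ) 1, z ≠ 0 → (F z)⁻¹ = z⁻¹ + p z) : ‖deriv p 0‖ ≤ 5 := by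
  set c := deriv p 0 with hc
  have h0U : (0 : ℂ) ∈ ball (0 : ℂ) 1 := by simp
  have hFne : ∀ z ∈ ball (0 : ℂ) 1, z ≠ 0 → F z ≠ 0 := by
    intro z hz hz0 h
    exact hz0 (hFi hz h0U (by rw [h, hF0]))
  -- smallness of p
  have hpd : HasDerivAt p c 0 := (hp.differentiableAt (isOpen_ball.mem_nhds h0U)).hasDerivAt
  have hev : ∀ᶠ z in nhds (0 : ℂ), ‖p z‖ ≤ (‖c‖ + 1) * ‖z‖ := by
    have := (hasDerivAt_iff_isLittleO.1 hpd).def (c := 1) one_pos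
    filter_upwards [this] with z hz
    simp only [hp0, sub_zero, smul_eq_mul, one_mul] at hz
    calc ‖p z‖ = ‖(p z - z * c) + z * c‖ := by ring_nf
      _ ≤ ‖p z - z * c‖ + ‖z * c‖ := norm_add_le _ _
      _ ≤ _ := by rw [norm_mul]; linarith
  obtain ⟨ε, hε, hεp⟩ := Metric.eventually_nhds_iff_ball.1 hev
  set K := ‖c‖ + 1 with hK
  have hK1 : 1 ≤ K := by have := norm_nonneg c; linarith
  obtain ⟨ρ, hρ0, hρ1⟩ : ∃ ρ : ℝ, 0 < ρ ∧ ρ < min ε (1 / (100 * K)) :=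
    exists_between (lt_min hε (by positivity))
  have hρε : ρ < ε := hρ1.trans_le (min_le_left _ _)
  have hρK : ρ * K < 1 / 100 := by
    have := hρ1.trans_le (min_le_right _ _)
    rw [lt_div_iff₀ (by positivity)] at this
    linarith
  have hρs : ρ < 1 / 100 := by nlinarith
  set r : ℝ := 4 / 5 with hr
  have hρr : ρ ≤ r := by rw [hr]; linarith
  set M := ρ⁻¹ + K * ρ with hM
  have hM0 : 0 < M := by positivity
  -- on the circle
  have hcirc : ∀ z : ℂ, ‖z‖ = ρ → M⁻¹ ≤ ‖F z‖ := by
    intro z hz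
    have hzb : z ∈ ball (0 : ℂ) 1 := by rw [mem_ball_zero_iff]; linarith
    have hz0 : z ≠ 0 := by rintro rfl; simp at hz; linarith
    have h1 := hεp z (by rw [mem_ball_zero_iff]; linarith)
    rw [hz] at h1
    have h2 : ‖(F z)⁻¹‖ ≤ M := by
      rw [hFp z hzb hz0]
      refine (norm_add_le _ _).trans ?_
      rw [norm_inv, hz]
      linarith
    rw [norm_inv] at h2
    exact inv_le_of_inv_le₀ (norm_pos_iff.2 (hFne z hzb hz0)) h2
  -- covering
  have hcbsub : closedBall (0 : ℂ) ρ ⊆ ball 0 1 := closedBall_subset_ball (by linarith)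
  have hcover : ball (0 : ℂ) M⁻¹ ⊆ F '' ball 0 ρ := by
    have hnc : ¬ ∃ w, ∀ z ∈ ball (0 : ℂ) 1, F z = w := by
      rintro ⟨w, hw⟩
      have h1 : (1 / 2 : ℂ) ∈ ball (0 : ℂ) 1 := by simp; norm_num
      have := hFi h0U h1 ((hw _ h0U).trans (hw _ h1).symm)
      norm_num at this
    have hop : IsOpen (F '' ball 0 ρ) :=
      ((hF.analyticOnNhd isOpen_ball).is_constant_or_isOpen
        (convex_ball (0 : ℂ) 1).isPreconnected |>.resolve_left hnc) _
        (ball_subset_closedBall.trans hcbsub) isOpen_ball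
    have hcl : IsClosed (F '' closedBall 0 ρ) :=
      ((isCompact_closedBall (0 : ℂ) ρ).image_of_continuousOn (hF.continuousOn.mono hcbsub)).isClosed
    refine IsPreconnected.subset_left_of_subset_union hop hcl.isOpen_compl ?_ ?_ ?_
      (convex_ball (0 : ℂ) M⁻¹).isPreconnected
    · rw [Set.disjoint_compl_right_iff_subset]
      exact Set.image_mono ball_subset_closedBall
    · intro w hw
      by_cases hwc : w ∈ F '' closedBall 0 ρ
      · obtain ⟨z, hz, rfl⟩ := hwc
        left
        refine ⟨z, ?_, rfl⟩
        rw [mem_closedBall_zero_iff] at hz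
        rw [mem_ball_zero_iff] at hw ⊢
        refine lt_of_le_of_ne hz fun heq => ?_
        exact absurd (hcirc z heq) (not_le.2 hw)
      · exact Or.inr hwc
    · exact ⟨0, mem_ball_self (by positivity), 0, mem_ball_self hρ0, hF0⟩
  set A := closedBall (0 : ℂ) r \ ball 0 ρ with hA
  have hAm : MeasurableSet A := measurableSet_closedBall.diff measurableSet_ball
  have hAc : IsCompact A := (isCompact_closedBall (0 : ℂ) r).diff isOpen_ball
  have hAsub : ∀ z ∈ A, z ∈ ball (0 : ℂ) 1 ∧ z ≠ 0 := by
    intro z hz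
    refine ⟨closedBall_subset_ball (by rw [hr]; norm_num) hz.1, ?_⟩
    rintro rfl
    exact hz.2 (mem_ball_self hρ0)
  set G : ℂ → ℂ := fun z => z⁻¹ + p z with hG
  have hGi : Set.InjOn G A := by
    intro z hz w hw h
    have h1 := hFp z (hAsub z hz).1 (hAsub z hz).2
    have h2 := hFp w (hAsub w hw).1 (hAsub w hw).2
    exact hFi (hAsub z hz).1 (hAsub w hw).1 (inv_injective (by rw [h1, h2]; exact h))
  have himg : G '' A ⊆ closedBall 0 M := by
    rintro _ ⟨w, hw, rfl⟩
    rw [mem_closedBall_zero_iff]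
    by_contra hcon
    rw [not_le] at hcon
    have hwF := hFp w (hAsub w hw).1 (hAsub w hw).2
    have : F w ∈ ball (0 : ℂ) M⁻¹ := by
      rw [mem_ball_zero_iff]
      have : F w = (G w)⁻¹ := by
        show F w = (w⁻¹ + p w)⁻¹
        rw [← hwF, inv_inv]
      rw [this, norm_inv]
      exact inv_strictAnti₀ hM0 hcon
    obtain ⟨z, hz, hzw⟩ := hcover this
    have := hFi (hcbsub (ball_subset_closedBall hz)) (hAsub w hw).1 hzw
    exact hw.2 (this ▸ hz)
  -- derivative
  set q := deriv p with hq
  have hqd : DifferentiableOn ℂ q (ball 0 1) := hp.deriv isOpen_ball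
  have hGd : ∀ z ∈ A, HasDerivAt G (-(z ^ 2)⁻¹ + q z) z := by
    intro z hz
    exact (hasDerivAt_inv (hAsub z hz).2).add
      (hp.differentiableAt (isOpen_ball.mem_nhds (hAsub z hz).1)).hasDerivAt
  set φ : ℂ → ℝ := fun z => ‖-(z ^ 2)⁻¹ + q z‖ ^ 2 with hφ
  have hφc : ContinuousOn φ A := by
    refine ((ContinuousOn.add ?_ (hqd.continuousOn.mono fun z hz => (hAsub z hz).1)).norm).pow 2
    refine (ContinuousOn.inv₀ (by fun_prop) ?_).neg
    intro z hz
    have := (hAsub z hz).2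
    positivity
  have harea := lintegral_abs_det_fderiv_eq_addHaar_image volume hAm
    (f' := fun z => ((ContinuousLinearMap.toSpanSingleton ℂ (-(z ^ 2)⁻¹ + q z)).restrictScalars ℝ))
    (fun z hz => ((hGd z hz).hasFDerivAt.restrictScalars ℝ).hasFDerivWithinAt) hGi
  have hle : ∫ z in A, φ z ≤ Real.pi * M ^ 2 := by
    have h1 : ENNReal.ofReal (∫ z in A, φ z) ≤ ENNReal.ofReal (Real.pi * M ^ 2) := by
      rw [ofReal_integral_eq_lintegral_ofReal (hφc.integrableOn_compact hAc)
        (Eventually.of_forall fun z => by positivity)]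
      have : ∫⁻ z in A, ENNReal.ofReal (φ z) = volume (G '' A) := by
        rw [← harea]
        congr 1
        ext z
        rw [det_mul_right, abs_of_nonneg (by positivity)]
      rw [this]
      refine (measure_mono himg).trans (le_of_eq ?_)
      rw [Complex.volume_closedBall, mul_comm, ENNReal.ofReal_mul Real.pi_pos.le, ENNReal.ofReal_pow hM0.le]
      congr 1
      rw [← NNReal.coe_real_pi, ENNReal.ofReal_coe_nnreal]
    exact (ENNReal.ofReal_le_ofReal_iff (by positivity)).1 h1
  have hlow := polar_lower (φ := φ) (ψ := fun s => 1 / s ^ 4 + ‖c‖ ^ 2) hρ0 hρr hφc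
    (by
      refine ContinuousOn.add (continuousOn_const.div (by fun_prop) ?_) continuousOn_const
      intro s hs
      have := hρ0.trans_le hs.1
      positivity)
    (fun s hs => circle_lower hqd (hρ0.trans_le hs.1) (by have := hs.2; rw [hr] at this; linarith))
  have h_integ : ∫ s in ρ..r, s * (1 / s ^ 4 + ‖c‖ ^ 2) =
      ((ρ ^ 2)⁻¹ - (r ^ 2)⁻¹) / 2 + ‖c‖ ^ 2 * (r ^ 2 - ρ ^ 2) / 2 := by
    have hd : ∀ s ∈ Set.uIcc ρ r, HasDerivAt (fun s : ℝ => -(s ^ 2)⁻¹ / 2 + ‖c‖ ^ 2 * s ^ 2 / 2)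
        (s * (1 / s ^ 4 + ‖c‖ ^ 2)) s := by
      intro s hs
      rw [Set.uIcc_of_le hρr] at hs
      have hs0 : s ≠ 0 := (hρ0.trans_le hs.1).ne'
      have h1 := ((((hasDerivAt_pow 2 s).inv (by positivity)).neg).div_const 2).add
        (((hasDerivAt_pow 2 s).const_mul (‖c‖ ^ 2)).div_const 2)
      convert! h1 using 1
      field_simp
      ring
    rw [intervalIntegral.integral_eq_sub_of_hasDerivAt hd]
    · ring
    · apply ContinuousOn.intervalIntegrable
      rw [Set.uIcc_of_le hρr]
      refine continuousOn_id.mul (ContinuousOn.add (continuousOn_const.div (by fun_prop) ?_) continuousOn_const)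
      intro s hs
      have := hρ0.trans_le hs.1
      positivity
  have hfin := hlow.trans hle
  rw [h_integ] at hfin
  have h1 : ((ρ ^ 2)⁻¹ - (r ^ 2)⁻¹) + ‖c‖ ^ 2 * (r ^ 2 - ρ ^ 2) ≤ M ^ 2 := by
    have := Real.pi_pos
    have h2 : Real.pi * (((ρ ^ 2)⁻¹ - (r ^ 2)⁻¹) + ‖c‖ ^ 2 * (r ^ 2 - ρ ^ 2)) ≤ Real.pi * M ^ 2 := by
      linarith
    exact le_of_mul_le_mul_left h2 this
  have h2 : M ^ 2 = (ρ ^ 2)⁻¹ + 2 * K + (ρ * K) ^ 2 := by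
    rw [hM]; field_simp; ring
  rw [h2, hr] at h1
  by_contra hcon
  rw [not_le] at hcon
  have h3 : ‖c‖ ^ 2 * ρ ^ 2 ≤ 1 / 10000 := by
    have : ‖c‖ * ρ ≤ 1 / 100 := by nlinarith
    have h0 : 0 ≤ ‖c‖ * ρ := by positivity
    nlinarith
  have h4 : (ρ * K) ^ 2 ≤ 1 / 10000 := by
    have h0 : 0 ≤ ρ * K := by positivity
    nlinarith
  norm_num at h1
  nlinarith

lemma exists_holo_log_s19 {f : ℂ → ℂ} (hf : DifferentiableOn ℂ f (ball 0 1))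
    (h0 : ∀ z ∈ ball (0 : ℂ) 1, f z ≠ 0) :
    ∃ b : ℂ → ℂ, ∀ z ∈ ball (0 : ℂ) 1, HasDerivAt b (deriv f z / f z) z ∧ Complex.exp (b z) = f z := by
  have hd : DifferentiableOn ℂ (fun z => deriv f z / f z) (ball 0 1) :=
    (hf.deriv isOpen_ball).div hf h0
  obtain ⟨b, hb0, hb⟩ := hd.isExactOn_ball.with_val_at 0 (Complex.log (f 0))
  have h00 : (0 : ℂ) ∈ ball (0 : ℂ) 1 := by simp
  have hk : ∀ z ∈ ball (0 : ℂ) 1, HasDerivAt (fun z => f z * Complex.exp (-b z)) 0 z := by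
    intro z hz
    have h1 := (hf.differentiableAt (isOpen_ball.mem_nhds hz)).hasDerivAt
    have h2 := (hb z hz).neg.cexp
    have h3 := h1.mul h2
    have := h0 z hz
    have e : (0 : ℂ) = deriv f z * Complex.exp (-b z) + f z * (Complex.exp (-b z) * -(deriv f z / f z)) := by
      field_simp
      ring
    rw [e]
    exact h3
  refine ⟨b, fun z hz => ⟨hb z hz, ?_⟩⟩
  obtain ⟨w, hw⟩ := isOpen_ball.exists_is_const_of_deriv_eq_zero (convex_ball (0 : ℂ) 1).isPreconnected
    (fun z hz => (hk z hz).differentiableAt.differentiableWithinAt) (fun z hz => (hk z hz).deriv)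
  have e1 := hw z hz
  have e2 := hw 0 h00
  simp only [hb0, Complex.exp_neg, Complex.exp_log (h0 0 h00)] at e1 e2
  rw [mul_inv_cancel₀ (h0 0 h00)] at e2
  rw [← e2] at e1
  have := Complex.exp_ne_zero (b z)
  field_simp at e1
  exact e1.symm

lemma second_coeff {f : ℂ → ℂ} (hf : DifferentiableOn ℂ f (ball 0 1))
    (hi : Set.InjOn f (ball 0 1)) (hf0 : f 0 = 0) (hf1 : deriv f 0 = 1) :
    ‖deriv (deriv f) 0‖ ≤ 20 := by
  have h00 : (0 : ℂ) ∈ ball (0 : ℂ) 1 := by simp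
  have hn0 : ball (0 : ℂ) 1 ∈ nhds (0 : ℂ) := isOpen_ball.mem_nhds h00
  set g := dslope f 0 with hg
  have hgd : DifferentiableOn ℂ g (ball 0 1) := (Complex.differentiableOn_dslope hn0).2 hf
  have hgf : ∀ z, f z = z * g z := by
    intro z
    have := sub_smul_dslope f 0 z
    simp only [hf0, sub_zero, smul_eq_mul] at this
    exact this.symm
  have hg0 : g 0 = 1 := by rw [hg, dslope_same, hf1]
  have hgne : ∀ z ∈ ball (0 : ℂ) 1, g z ≠ 0 := by
    intro z hz h
    by_cases hz0 : z = 0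
    · rw [hz0, hg0] at h; exact one_ne_zero h
    · exact hz0 (hi hz h00 (by rw [hgf z, h, mul_zero, hf0]))
  obtain ⟨b, hb⟩ := exists_holo_log_s19 hgd hgne
  -- second derivative of f at 0
  have hf2 : deriv (deriv f) 0 = 2 * deriv g 0 := by
    have hgD := hgd.deriv isOpen_ball
    have e : deriv f =ᶠ[nhds 0] fun z => g z + z * deriv g z := by
      filter_upwards [hn0] with z hz
      have h1 := (hasDerivAt_id z).mul (hgd.differentiableAt (isOpen_ball.mem_nhds hz)).hasDerivAt
      have h2 : f = (id * g) := by ext w; exact hgf w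
      rw [h2, h1.deriv]; simp
    rw [e.deriv_eq]
    have h1 := (hgd.differentiableAt hn0).hasDerivAt
    have h2 := (hasDerivAt_id (0 : ℂ)).mul (hgD.differentiableAt hn0).hasDerivAt
    have h3 := (h1.add h2).deriv
    have h4 : (fun z => g z + z * deriv g z) = g + id * deriv g := by ext; rfl
    rw [h4, h3]; simp; ring
  set c : ℂ := Complex.exp (b 0 / 2) with hc
  have hcc : c ^ 2 = 1 := by
    rw [hc, ← Complex.exp_nat_mul, ← hg0, ← (hb 0 h00).2]; congr 1; push_cast; ring
  have hcne : c ≠ 0 := Complex.exp_ne_zero _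
  set h : ℂ → ℂ := fun z => c * Complex.exp (b z / 2) with hh
  set k : ℂ → ℂ := fun z => c * Complex.exp (-(b z / 2)) with hk
  have hhk : ∀ z, (h z)⁻¹ = k z := by
    intro z
    have : c⁻¹ = c := by field_simp; exact hcc.symm
    simp only [hh, hk, mul_inv, this, Complex.exp_neg]
  have hh2 : ∀ z ∈ ball (0 : ℂ) 1, h z ^ 2 = g z := by
    intro z hz
    simp only [hh, mul_pow, hcc, one_mul]
    rw [← Complex.exp_nat_mul, ← (hb z hz).2]; congr 1; push_cast; ring
  have hhne : ∀ z, h z ≠ 0 := fun z => mul_ne_zero hcne (Complex.exp_ne_zero _)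
  have hk0 : k 0 = 1 := by
    have : k 0 = c * c⁻¹ := by simp only [hk, Complex.exp_neg, hc]
    rw [this, mul_inv_cancel₀ hcne]
  have hkd : ∀ z ∈ ball (0 : ℂ) 1, HasDerivAt k (k z * (-(deriv g z / g z / 2))) z := by
    intro z hz
    have := (((hb z hz).1.div_const 2).neg.cexp).const_mul c
    have e : k z * (-(deriv g z / g z / 2)) =
        c * (Complex.exp (-(b z / 2)) * -(deriv g z / g z / 2)) := by
      simp only [hk]; ring
    rw [e]
    exact this
  have hhd : ∀ z ∈ ball (0 : ℂ) 1, DifferentiableAt ℂ h z := by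
    intro z hz
    exact ((((hb z hz).1.div_const 2).cexp).const_mul c).differentiableAt
  set q := dslope k 0 with hq
  have hqd : DifferentiableOn ℂ q (ball 0 1) :=
    (Complex.differentiableOn_dslope hn0).2 fun z hz => (hkd z hz).differentiableAt.differentiableWithinAt
  have hqk : ∀ z, k z = 1 + z * q z := by
    intro z
    have := sub_smul_dslope k 0 z
    simp only [hk0, sub_zero, smul_eq_mul] at this
    rw [← hq] at this
    rw [this]; ring
  have hq0 : q 0 = -(deriv g 0 / 2) := by
    rw [hq, dslope_same, (hkd 0 h00).deriv, hk0, hg0]; ring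
  have hsq : ∀ z ∈ ball (0 : ℂ) 1, z ^ 2 ∈ ball (0 : ℂ) 1 := by
    intro z hz
    rw [mem_ball_zero_iff] at hz ⊢
    rw [norm_pow]; exact pow_lt_one₀ (norm_nonneg _) hz two_ne_zero
  have hqsq : ∀ z ∈ ball (0 : ℂ) 1, DifferentiableAt ℂ (fun z => q (z ^ 2)) z := by
    intro z hz
    exact DifferentiableAt.comp z (hqd.differentiableAt (isOpen_ball.mem_nhds (hsq z hz)))
      (differentiableAt_id.pow 2)
  have key := area_bound (F := fun z => z * h (z ^ 2)) (p := fun z => z * q (z ^ 2)) ?_ ?_ (by simp) ?_ (by simp) ?_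
  · have hd : deriv (fun z => z * q (z ^ 2)) 0 = q 0 := by
      have h1 := ((hasDerivAt_id (0 : ℂ)).mul (hqsq 0 h00).hasDerivAt).deriv
      have h2 : (fun z => z * q (z ^ 2)) = id * fun z => q (z ^ 2) := by ext; rfl
      rw [h2, h1]; simp
    rw [hd, hq0, norm_neg, norm_div] at key
    rw [hf2, norm_mul]
    simp only [Complex.norm_ofNat] at key ⊢
    linarith
  · intro z hz
    refine (differentiableAt_id.mul ?_).differentiableWithinAt
    exact DifferentiableAt.comp (g := h) (f := fun z : ℂ => z ^ 2) z (hhd _ (hsq z hz)) (differentiableAt_id.pow 2)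
  · intro z hz w hw hzw
    simp only at hzw
    have e1 : ∀ z ∈ ball (0 : ℂ) 1, f (z ^ 2) = (z * h (z ^ 2)) ^ 2 := by
      intro z hz
      rw [hgf, mul_pow, hh2 _ (hsq z hz)]
    have e2 : z ^ 2 = w ^ 2 := hi (hsq z hz) (hsq w hw) (by rw [e1 z hz, e1 w hw, hzw])
    rw [e2] at hzw
    exact mul_right_cancel₀ (hhne _) hzw
  · intro z hz
    exact (differentiableAt_id.mul (hqsq z hz)).differentiableWithinAt
  · intro z hz hz0
    simp only [mul_inv, hhk, hqk]
    field_simp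

lemma univ_bloch {R : ℂ → ℂ} (hR : DifferentiableOn ℂ R (ball 0 1))
    (hi : Set.InjOn R (ball 0 1)) {a : ℂ} (ha : a ∈ ball (0 : ℂ) 1) :
    ‖deriv (deriv R) a / deriv R a‖ ≤ 20 / (1 - ‖a‖) := by
  have hne := univ_deriv_ne_zero hR hi ha
  have ha' : ‖a‖ < 1 := by simpa using ha
  set d : ℝ := 1 - ‖a‖ with hd
  have hd0 : 0 < d := by linarith
  have hdc : (d : ℂ) ≠ 0 := by exact_mod_cast hd0.ne'
  set A : ℂ → ℂ := fun z => a + d * z with hA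
  have hAm : ∀ z ∈ ball (0 : ℂ) 1, A z ∈ ball (0 : ℂ) 1 := by
    intro z hz
    rw [mem_ball_zero_iff] at hz ⊢
    calc ‖a + d * z‖ ≤ ‖a‖ + ‖(d : ℂ) * z‖ := norm_add_le _ _
      _ = ‖a‖ + d * ‖z‖ := by rw [norm_mul, Complex.norm_real, Real.norm_of_nonneg hd0.le]
      _ < ‖a‖ + d * 1 := by gcongr
      _ = 1 := by rw [hd]; ring
  have hAd : ∀ z, HasDerivAt A d z := by
    intro z
    have := ((hasDerivAt_id z).const_mul (d : ℂ)).const_add a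
    rw [mul_one] at this
    exact this
  have h00 : (0 : ℂ) ∈ ball (0 : ℂ) 1 := by simp
  have hn0 : ball (0 : ℂ) 1 ∈ nhds (0 : ℂ) := isOpen_ball.mem_nhds h00
  have hA0 : A 0 = a := by simp [hA]
  have hRd := hR.deriv isOpen_ball
  set f : ℂ → ℂ := fun z => (R (A z) - R a) / (d * deriv R a) with hf
  have hfd : ∀ z ∈ ball (0 : ℂ) 1, HasDerivAt f (deriv R (A z) / deriv R a) z := by
    intro z hz
    have h1 := (hR.differentiableAt (isOpen_ball.mem_nhds (hAm z hz))).hasDerivAt.comp z (hAd z)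
    have h2 := (h1.sub_const (R a)).div_const (d * deriv R a)
    have e : deriv R (A z) / deriv R a = deriv R (A z) * d / (d * deriv R a) := by field_simp
    rw [e]
    exact h2
  have hfdd : deriv (deriv f) 0 = deriv (deriv R) a * d / deriv R a := by
    have e : deriv f =ᶠ[nhds 0] fun z => deriv R (A z) / deriv R a := by
      filter_upwards [hn0] with z hz using (hfd z hz).deriv
    rw [e.deriv_eq]
    have h1 := (hRd.differentiableAt (isOpen_ball.mem_nhds (hAm 0 h00))).hasDerivAt.comp 0 (hAd 0)
    have h2 := (h1.div_const (deriv R a)).deriv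
    rw [hA0] at h2
    exact h2
  have key := second_coeff (f := f) (fun z hz => (hfd z hz).differentiableAt.differentiableWithinAt) ?_
    (by simp [hf, hA0]) (by rw [(hfd 0 h00).deriv, hA0, div_self hne])
  · rw [hfdd, mul_div_right_comm, norm_mul, Complex.norm_real, Real.norm_of_nonneg hd0.le] at key
    rwa [le_div_iff₀ hd0]
  · intro z hz w hw hzw
    simp only [hf] at hzw
    have h1 : R (A z) = R (A w) := by
      field_simp at hzw
      simpa using hzw
    have h2 := hi (hAm z hz) (hAm w hw) h1
    simp only [hA, add_right_inj] at h2
    exact mul_left_cancel₀ hdc h2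

lemma limsup_bound {R b : ℂ → ℂ} {C θ : ℝ}
    (hb : ∀ z ∈ ball (0 : ℂ) 1, Complex.exp (b z) = deriv R z)
    (h1 : ∀ᶠ L : ℝ in atTop, ∀ y : ℝ, 0 < y → y ≤ 1 → -Real.log y ≤ L →
      (b (Complex.exp (I * ((θ : ℂ) + y * I)))).re ≤ C * √(L * Real.log (Real.log L)))
    (h2 : ∀ᶠ L : ℝ in atTop, ∀ y : ℝ, 0 < y → y ≤ 1 → -Real.log y ≤ L →
      (-b (Complex.exp (I * ((θ : ℂ) + y * I)))).re ≤ C * √(L * Real.log (Real.log L)))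
    (hC : 0 ≤ C) :
    limsup (fun r : ℝ =>
            |Real.log ‖deriv R ((r : ℂ) * Complex.exp ((θ : ℂ) * Complex.I))‖| /
              Real.sqrt (Real.log (1 / (1 - r)) *
                Real.log (Real.log (Real.log (1 / (1 - r))))))
          (nhdsWithin 1 (Set.Iio 1)) ≤ C := by
  have hL : Tendsto (fun r : ℝ => Real.log (1 / (1 - r))) (nhdsWithin 1 (Set.Iio 1)) atTop := by
    refine Real.tendsto_log_atTop.comp ?_
    simp only [one_div]
    refine tendsto_inv_nhdsGT_zero.comp ?_
    refine tendsto_nhdsWithin_iff.2 ⟨?_, ?_⟩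
    · have : Tendsto (fun r : ℝ => 1 - r) (nhds 1) (nhds (1 - 1)) := by
        exact (continuous_const.sub continuous_id).tendsto 1
      rw [sub_self] at this
      exact this.mono_left nhdsWithin_le_nhds
    · filter_upwards [self_mem_nhdsWithin] with r hr
      simpa using hr
  have hr0 : ∀ᶠ r : ℝ in nhdsWithin 1 (Set.Iio 1), Real.exp (-1) < r :=
    nhdsWithin_le_nhds (lt_mem_nhds (by simp))
  refine limsup_le_of_le ?_ ?_
  · refine IsBoundedUnder.isCoboundedUnder_le ⟨0, ?_⟩
    rw [eventually_map]
    exact Eventually.of_forall fun r => by positivity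
  filter_upwards [hL.eventually h1, hL.eventually h2, hr0, self_mem_nhdsWithin] with r k1 k2 hr hr1
  have hr1' : r < 1 := hr1
  have hrpos : 0 < r := (Real.exp_pos _).trans hr
  set y := -Real.log r with hy
  have hy0 : 0 < y := by have := Real.log_neg hrpos hr1'; linarith
  have hy1 : y ≤ 1 := by
    have := (Real.lt_log_iff_exp_lt hrpos).2 hr
    linarith
  have hyL : -Real.log y ≤ Real.log (1 / (1 - r)) := by
    rw [one_div, Real.log_inv]
    have h3 : 1 - r ≤ y := by have := Real.log_le_sub_one_of_pos hrpos; linarith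
    have := Real.log_le_log (by linarith) h3
    linarith
  have hz : Complex.exp (I * ((θ : ℂ) + y * I)) = (r : ℂ) * Complex.exp ((θ : ℂ) * Complex.I) := by
    have e1 : I * ((θ : ℂ) + y * I) = ((Real.log r : ℝ) : ℂ) + θ * I := by
      rw [hy]; push_cast
      have := Complex.I_mul_I
      linear_combination (-((Real.log r : ℝ) : ℂ)) * this
    rw [e1, Complex.exp_add, ← Complex.ofReal_exp, Real.exp_log hrpos]
  have hmem : (r : ℂ) * Complex.exp ((θ : ℂ) * Complex.I) ∈ ball (0 : ℂ) 1 := by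
    rw [mem_ball_zero_iff, norm_mul, Complex.norm_exp_ofReal_mul_I, Complex.norm_real,
      Real.norm_of_nonneg hrpos.le, mul_one]
    exact hr1'
  have k1 := k1 y hy0 hy1 hyL
  have k2 := k2 y hy0 hy1 hyL
  rw [hz] at k1 k2
  rw [← hb _ hmem, Complex.norm_exp, Real.log_exp]
  refine div_le_of_le_mul₀ (Real.sqrt_nonneg _) hC ?_
  rw [Complex.neg_re] at k2
  exact abs_le.2 ⟨by linarith, k1⟩

lemma log_hpbloch {b b' : ℂ → ℂ} {B : ℝ} (hB : 0 ≤ B)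
    (hb : ∀ z ∈ ball (0 : ℂ) 1, HasDerivAt b (b' z) z)
    (hbd : ∀ z ∈ ball (0 : ℂ) 1, ‖b' z‖ ≤ B / (1 - ‖z‖)) :
    HPBloch (fun w => b (Complex.exp (I * w))) B := by
  refine ⟨hB, fun w hw => ?_⟩
  have hn : ‖Complex.exp (I * w)‖ = Real.exp (-w.im) := by
    rw [Complex.norm_exp]; simp
  have hlt : Real.exp (-w.im) < 1 := by simpa using hw
  have hmem : Complex.exp (I * w) ∈ ball (0 : ℂ) 1 := by
    rw [mem_ball_zero_iff, hn]; exact hlt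
  have h1 : HasDerivAt (fun w => Complex.exp (I * w)) (Complex.exp (I * w) * I) w := by
    simpa using ((hasDerivAt_id w).const_mul I).cexp
  have h2 := (hb _ hmem).comp w h1
  have h3 : HasDerivAt (fun w => b (Complex.exp (I * w))) _ w := h2
  refine ⟨h3.differentiableAt, ?_⟩
  rw [h3.deriv, norm_mul, norm_mul, Complex.norm_I, mul_one, hn]
  have h4 := hbd _ hmem
  rw [hn] at h4
  have h5 : 0 < 1 - Real.exp (-w.im) := by linarith
  have hE := Real.exp_pos (-w.im)
  calc _ ≤ B / (1 - Real.exp (-w.im)) * Real.exp (-w.im) := by gcongr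
    _ ≤ B / w.im := by
      rw [div_mul_eq_mul_div, div_le_div_iff₀ h5 hw]
      have h6 : w.im + 1 ≤ Real.exp w.im := Real.add_one_le_exp _
      have h7 : Real.exp (-w.im) * Real.exp w.im = 1 := by rw [← Real.exp_add]; simp
      have h8 : Real.exp (-w.im) * w.im ≤ 1 - Real.exp (-w.im) := by nlinarith
      nlinarith

lemma final_ae_all {g : ℂ → ℂ} {B : ℝ} (hg : HPBloch g B) (hB : 0 < B) :
    ∀ᵐ x : ℝ, ∀ᶠ L : ℝ in atTop, ∀ y : ℝ, 0 < y → y ≤ 1 → -Real.log y ≤ L →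
      (g (x + y * I)).re ≤ (54 * B + 1) * √(L * Real.log (Real.log L)) := by
  have := ae_all_iff.2 fun n : ℤ => hg.final_ae hB (n : ℝ)
  filter_upwards [this] with x hx
  exact hx ⌊x⌋ ⟨Int.floor_le x, Int.lt_floor_add_one x⟩


/-- **Makarov's universal bound for the radial growth of `log |R′|`.** There is a
finite universal constant `C_M` such that for every univalent (injective
holomorphic) map `R` on the unit disc, for Lebesgue-a.e. `θ ∈ [0, 2π)`,
`limsup_{r→1⁻} |log |R′(r e^{iθ})|| / √(log (1/(1-r)) · log log log (1/(1-r))) ≤ C_M`. -/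
theorem makarov_universal_LIL_bound :
    ∃ C_M : ℝ, ∀ R : ℂ → ℂ,
      DifferentiableOn ℂ R (ball (0 : ℂ) 1) →
      Set.InjOn R (ball (0 : ℂ) 1) →
      ∀ᵐ (θ : ℝ) ∂(volume.restrict (Set.Ico (0 : ℝ) (2 * Real.pi))),
        limsup (fun r : ℝ =>
            |Real.log ‖deriv R ((r : ℂ) * Complex.exp ((θ : ℂ) * Complex.I))‖| /
              Real.sqrt (Real.log (1 / (1 - r)) *
                Real.log (Real.log (Real.log (1 / (1 - r))))))
          (nhdsWithin 1 (Set.Iio 1)) ≤ C_M := by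
  refine ⟨54 * 20 + 1, fun R hR hi => ?_⟩
  obtain ⟨b, hb⟩ := exists_holo_log_s19 (hR.deriv isOpen_ball) (fun z hz => univ_deriv_ne_zero hR hi hz)
  have g1 := log_hpbloch (b := b) (B := 20) (by norm_num) (fun z hz => (hb z hz).1)
    (fun z hz => univ_bloch hR hi hz)
  have g2 := log_hpbloch (b := -b) (b' := fun z => -(deriv (deriv R) z / deriv R z)) (B := 20) (by norm_num)
    (fun z hz => (hb z hz).1.neg)
    (fun z hz => by rw [norm_neg]; exact univ_bloch hR hi hz)
  refine ae_restrict_of_ae ?_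
  filter_upwards [final_ae_all g1 (by norm_num), final_ae_all g2 (by norm_num)] with θ h1 h2
  exact limsup_bound (fun z hz => (hb z hz).2) h1 h2 (by norm_num)
end
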